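/- Fix τ ∈ (1/e, 2) and let x be a Λ(τ)-oscillating solution of x'(t) = p(t)·x(τ̄(t)) on [t₀,∞) with |p| ≡ 1 and sup_{t ≥ t₀}(t - τ̄(t)) ≤ τ. Then, with M := limsup_{t→∞} |x(t)|, there exists η ∈ [0, Λ(τ)) such that |x(t)| - M·ϖ_τ(t + η) → 0 as t → ∞. -/

import Mathlib

open Real MeasureTheory Filter Set

noncomputable section

/-- `x` is the solution of `x'(t) = -x(t-τ)` with `x ≡ 1` on `(-∞,0]`:
`x(t) = 1 - ∫_0^t x(s-τ) ds` for `t ≥ 0`. -/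
def IsXSol (τ : ℝ) (x : ℝ → ℝ) : Prop :=
  Continuous x ∧ (∀ t ≤ (0:ℝ), x t = 1) ∧
    ∀ t ≥ (0:ℝ), x t = 1 - ∫ s in (0:ℝ)..t, x (s - τ)

/-- The first positive root of a function. -/
noncomputable def firstRoot (x : ℝ → ℝ) : ℝ := sInf {t : ℝ | 0 < t ∧ x t = 0}

/-- `ψ` is the solution of `ψ'(t) = max{x_τ(ϱ(τ)+t-τ), ψ(t)}` on `[0,τ]`,
`ψ'(t) = ψ(t)` on `[τ,∞)`, `ψ(0) = 0`. -/
def IsPsiSol (τ ρ : ℝ) (xτ ψ : ℝ → ℝ) : Prop :=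
  ContinuousOn ψ (Ici (0:ℝ)) ∧ ψ 0 = 0 ∧
    (∀ t ∈ Icc (0:ℝ) τ, ψ t = ∫ s in (0:ℝ)..t, max (xτ (ρ + s - τ)) (ψ s)) ∧
    (∀ t ≥ τ, ψ t = ψ τ + ∫ s in τ..t, ψ s)

/-- A (continuous, integrated-form) solution of the delay equation
`x'(t) = p(t) x(τ̄(t))` on `[t₀,∞)`. -/
def IsDelaySolution (p τd : ℝ → ℝ) (t₀ : ℝ) (x : ℝ → ℝ) : Prop :=
  Continuous x ∧ ∀ t ≥ t₀, x t = x t₀ + ∫ s in t₀..t, p s * x (τd s)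

/-- `x` is `α`-oscillating: eventually every interval on which `x` has no zero
has length at most `α`. -/
def AlphaOscillating (α : ℝ) (x : ℝ → ℝ) : Prop :=
  ∃ T : ℝ, ∀ a b : ℝ, T ≤ a → a < b → (∀ t ∈ Ioo a b, x t ≠ 0) → b - a ≤ α

/-- `x` is oscillatory: it has arbitrarily large zeros. -/
def Oscillatory (x : ℝ → ℝ) : Prop := ∀ T : ℝ, ∃ t ≥ T, x t = 0

section FundamentalSolution

variable {τ : ℝ} {X : ℝ → ℝ}

theorem IsXSol.eq_sub_integral (hX : IsXSol τ X) {a b : ℝ} (ha : 0 ≤ a) (hb : 0 ≤ b) :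
    X b = X a - ∫ s in a..b, X (s - τ) := by
  have hc : Continuous fun s => X (s - τ) := hX.1.comp (continuous_id.sub continuous_const)
  have h := intervalIntegral.integral_add_adjacent_intervals
    (hc.intervalIntegrable (μ := volume) 0 a) (hc.intervalIntegrable a b)
  rw [hX.2.2 b hb, hX.2.2 a ha]
  linarith

theorem IsXSol.hasDerivAt (hX : IsXSol τ X) {t : ℝ} (ht : 0 < t) :
    HasDerivAt X (-X (t - τ)) t := by
  have hc : Continuous fun s => X (s - τ) := hX.1.comp (continuous_id.sub continuous_const)
  have h : HasDerivAt (fun u => X 0 - ∫ s in (0:ℝ)..u, X (s - τ)) (-X (t - τ)) t :=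
    (hc.integral_hasStrictDerivAt 0 t).hasDerivAt.const_sub _
  refine h.congr_of_eventuallyEq ?_
  filter_upwards [lt_mem_nhds ht] with u hu
  exact hX.eq_sub_integral le_rfl hu.le

/-- If the fundamental solution never vanishes, it is everywhere positive. -/
theorem IsXSol.pos_of_no_root (hX : IsXSol τ X) {r : ℝ}
    (h : ∀ t, 0 < t → t < r → X t ≠ 0) : ∀ t < r, 0 < X t := by
  intro t ht
  rcases le_or_gt t 0 with h0 | h0
  · rw [hX.2.1 t h0]; exact one_pos
  by_contra hn
  have h1 : (0:ℝ) ∈ Icc (X t) (X 0) := ⟨not_lt.mp hn, by rw [hX.2.1 0 le_rfl]; exact zero_le_one⟩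
  obtain ⟨s, hs, hs0⟩ := intermediate_value_Icc' h0.le hX.1.continuousOn h1
  have hs1 : s ≠ 0 := by
    rintro rfl
    rw [hX.2.1 0 le_rfl] at hs0
    exact one_ne_zero hs0
  exact h s (lt_of_le_of_ne hs.1 (Ne.symm hs1)) (hs.2.trans_lt ht) hs0

/-- For `τ > 1/e` the fundamental solution has a positive root. -/
theorem IsXSol.exists_root (hX : IsXSol τ X) (hτ : 1 / Real.exp 1 < τ) :
    ∃ t, 0 < t ∧ X t = 0 := by
  by_contra hn
  push Not at hn
  have hτ0 : 0 < τ := lt_trans (by positivity) hτ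
  have heτ : 1 < Real.exp 1 * τ := by
    rw [div_lt_iff₀ (Real.exp_pos 1)] at hτ
    linarith
  have hpos : ∀ t, 0 < X t := fun t =>
    hX.pos_of_no_root (r := t + 1) (fun s hs _ => hn s hs) t (by linarith)
  have hanti : ∀ a b, 0 ≤ a → a ≤ b → X b ≤ X a := by
    intro a b ha hab
    rw [hX.eq_sub_integral ha (ha.trans hab)]
    have : 0 ≤ ∫ s in a..b, X (s - τ) :=
      intervalIntegral.integral_nonneg hab fun s _ => (hpos _).le
    linarith
  have hc : Continuous fun s => X (s - τ) := hX.1.comp (continuous_id.sub continuous_const)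
  -- the quotient `X (t - τ) / X t` is bounded
  have hhalf : ∀ t, τ ≤ t → τ / 2 * X (t - τ / 2) ≤ X t := by
    intro t ht
    have h1 := hX.eq_sub_integral (a := t) (b := t + τ / 2) (by linarith) (by linarith)
    have h2 : ∫ s in t..(t + τ / 2), X (t - τ / 2) ≤ ∫ s in t..(t + τ / 2), X (s - τ) := by
      refine intervalIntegral.integral_mono_on (by linarith) (by simp)
        (hc.intervalIntegrable _ _) fun s hs => ?_
      exact hanti _ _ (by linarith [hs.1]) (by linarith [hs.2])
    rw [intervalIntegral.integral_const, smul_eq_mul] at h2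
    have h3 := hpos (t + τ / 2)
    have h4 : t + τ / 2 - t = τ / 2 := by ring
    rw [h4] at h2
    linarith
  have hbound : ∀ t, 2 * τ ≤ t → (τ / 2) * (τ / 2) * X (t - τ) ≤ X t := by
    intro t ht
    have h1 := hhalf t (by linarith)
    have h2 := hhalf (t - τ / 2) (by linarith)
    have h3 : t - τ / 2 - τ / 2 = t - τ := by ring
    rw [h3] at h2
    nlinarith [mul_le_mul_of_nonneg_left h2 (by positivity : (0:ℝ) ≤ τ / 2)]
  have hiter : ∀ n : ℕ, ∃ T, ∀ t ≥ T, (Real.exp 1 * τ) ^ n * X t ≤ X (t - τ) := by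
    intro n
    induction n with
    | zero =>
      refine ⟨τ, fun t ht => ?_⟩
      rw [pow_zero, one_mul]
      exact hanti _ _ (by linarith) (by linarith)
    | succ n ih =>
      obtain ⟨T, hT⟩ := ih
      set l := (Real.exp 1 * τ) ^ n with hl
      have hl0 : 0 < l := by positivity
      refine ⟨max T 1 + τ, fun t ht => ?_⟩
      have htT : T ≤ t - τ := by linarith [le_max_left T 1]
      have ht1 : 1 ≤ t - τ := by linarith [le_max_right T 1]
      -- `exp (l s) X s` is nonincreasing on `[t - τ, t]`
      have hd : ∀ s, 0 < s → HasDerivAt (fun s => Real.exp (l * s) * X s)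
          (Real.exp (l * s) * l * X s + Real.exp (l * s) * (-X (s - τ))) s := by
        intro s hs
        have h1 : HasDerivAt (fun s => Real.exp (l * s)) (Real.exp (l * s) * l) s := by
          simpa using ((hasDerivAt_id s).const_mul l).exp
        exact h1.mul (hX.hasDerivAt hs)
      have hA : AntitoneOn (fun s => Real.exp (l * s) * X s) (Icc (t - τ) t) := by
        refine antitoneOn_of_deriv_nonpos (convex_Icc _ _) ?_ ?_ ?_
        · intro s hs
          exact (hd s (by linarith [hs.1])).continuousAt.continuousWithinAt
        · intro s hs
          rw [interior_Icc] at hs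
          exact (hd s (by linarith [hs.1])).differentiableAt.differentiableWithinAt
        · intro s hs
          rw [interior_Icc] at hs
          rw [(hd s (by linarith [hs.1])).deriv]
          have h1 := hT s (by linarith [hs.1])
          have h2 := Real.exp_pos (l * s)
          nlinarith
      have h1 := hA (left_mem_Icc.mpr (by linarith)) (right_mem_Icc.mpr (by linarith))
        (by linarith : t - τ ≤ t)
      simp only at h1
      have h2 : Real.exp (l * t) = Real.exp (l * (t - τ)) * Real.exp (l * τ) := by
        rw [← Real.exp_add]; congr 1; ring
      have h3 : Real.exp (l * τ) * X t ≤ X (t - τ) := by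
        have := Real.exp_pos (l * (t - τ))
        rw [h2, mul_assoc] at h1
        exact le_of_mul_le_mul_left h1 this
      have h4 : Real.exp 1 * (l * τ) ≤ Real.exp (l * τ) := by
        have h5 := Real.add_one_le_exp (l * τ - 1)
        have h6 : Real.exp (l * τ) = Real.exp 1 * Real.exp (l * τ - 1) := by
          rw [← Real.exp_add]; congr 1; ring
        rw [h6]
        exact mul_le_mul_of_nonneg_left (by linarith) (Real.exp_pos 1).le
      calc (Real.exp 1 * τ) ^ (n + 1) * X t = Real.exp 1 * (l * τ) * X t := by
            rw [pow_succ, ← hl]; ring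
        _ ≤ Real.exp (l * τ) * X t := mul_le_mul_of_nonneg_right h4 (hpos t).le
        _ ≤ X (t - τ) := h3
  obtain ⟨n, hn⟩ := pow_unbounded_of_one_lt (1 / ((τ / 2) * (τ / 2))) heτ
  obtain ⟨T, hT⟩ := hiter n
  have h1 := hT (max T (2 * τ)) (le_max_left _ _)
  have h2 := hbound (max T (2 * τ)) (le_max_right _ _)
  have h3 := hpos (max T (2 * τ))
  have h4 : (0:ℝ) < (τ / 2) * (τ / 2) := by positivity
  rw [div_lt_iff₀ h4] at hn
  nlinarith [mul_le_mul_of_nonneg_left h1 h4.le]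

theorem IsXSol.firstRoot_spec (hX : IsXSol τ X) (hτ : 1 / Real.exp 1 < τ) :
    0 < firstRoot X ∧ X (firstRoot X) = 0 ∧ ∀ t < firstRoot X, 0 < X t := by
  have hset : {t : ℝ | 0 < t ∧ X t = 0} = Ici 0 ∩ X ⁻¹' {0} := by
    ext t
    simp only [mem_ofPred_eq, mem_inter_iff, mem_Ici, mem_preimage, mem_singleton_iff]
    refine ⟨fun h => ⟨h.1.le, h.2⟩, fun h => ⟨lt_of_le_of_ne h.1 ?_, h.2⟩⟩
    rintro rfl
    have := hX.2.1 0 le_rfl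
    rw [h.2] at this
    exact zero_ne_one this
  have hcl : IsClosed {t : ℝ | 0 < t ∧ X t = 0} := by
    rw [hset]
    exact isClosed_Ici.inter (isClosed_singleton.preimage hX.1)
  have hbdd : BddBelow {t : ℝ | 0 < t ∧ X t = 0} := ⟨0, fun t ht => ht.1.le⟩
  have hmem := hcl.csInf_mem (hX.exists_root hτ) hbdd
  refine ⟨hmem.1, hmem.2, hX.pos_of_no_root fun t h0 ht h => ?_⟩
  exact absurd (csInf_le hbdd ⟨h0, h⟩) (not_le.mpr ht)

end FundamentalSolution

/-- The decay profile `X` (the fundamental solution stopped at its first root `ρ`) and the growth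
profile `ψ` (extended by zero to negative times), which reaches the value `1` at time `L`. -/
structure Profile (τ ρ L : ℝ) (X ψ : ℝ → ℝ) : Prop where
  τ_pos : 0 < τ
  ρ_pos : 0 < ρ
  L_pos : 0 < L
  τ_lt : τ < ρ + L
  X_cont : Continuous X
  X_anti : Antitone X
  X_strict : StrictAntiOn X (Icc 0 ρ)
  X_of_nonpos : ∀ t ≤ 0, X t = 1
  X_of_ge : ∀ t ≥ ρ, X t = 0
  X_step : ∀ u v, 0 ≤ u → u ≤ v → v ≤ ρ → X v = X u - ∫ s in u..v, X (s - τ)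
  ψ_cont : Continuous ψ
  ψ_mono : Monotone ψ
  ψ_strict : StrictMonoOn ψ (Ici 0)
  ψ_of_nonpos : ∀ t ≤ 0, ψ t = 0
  ψ_step : ∀ u v, 0 ≤ u → u ≤ v →
    ψ v = ψ u + ∫ s in u..v, max (X (ρ + s - τ)) (ψ s)
  ψ_L : ψ L = 1

theorem IsXSol.profile {τ ρ Λ : ℝ} {x ψ : ℝ → ℝ} (hx : IsXSol τ x)
    (hτ : τ ∈ Ioo (1 / Real.exp 1) 2) (hρ : ρ = firstRoot x) (hψ : IsPsiSol τ ρ x ψ)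
    (hΛ : ρ < Λ ∧ ψ (Λ - ρ) = 1) :
    Profile τ ρ (Λ - ρ) (fun t => x (min t ρ)) (fun t => ψ (max t 0)) := by
  have hτ0 : 0 < τ := lt_trans (by positivity) hτ.1
  obtain ⟨hρ0, hxρ, hpos⟩ := hx.firstRoot_spec hτ.1
  rw [← hρ] at hρ0 hxρ hpos
  have hnn : ∀ t ≤ ρ, 0 ≤ x t := fun t ht => by
    rcases ht.lt_or_eq with h | h
    · exact (hpos t h).le
    · rw [h, hxρ]
  have hcx : Continuous fun s => x (s - τ) := hx.1.comp (continuous_id.sub continuous_const)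
  have hstrict : ∀ u v, 0 ≤ u → u < v → v ≤ ρ → x v < x u := by
    intro u v hu huv hv
    rw [hx.eq_sub_integral hu (hu.trans huv.le)]
    have : 0 < ∫ s in u..v, x (s - τ) :=
      intervalIntegral.intervalIntegral_pos_of_pos_on (hcx.intervalIntegrable _ _)
        (fun s hs => hpos _ (by linarith [hs.2])) huv
    linarith
  have hanti : ∀ u v, u ≤ v → v ≤ ρ → x v ≤ x u := by
    intro u v huv hv
    rcases le_or_gt v 0 with h0 | h0
    · rw [hx.2.1 v h0, hx.2.1 u (huv.trans h0)]
    · rcases le_or_gt 0 u with h1 | h1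
      · rcases huv.lt_or_eq with h | h
        · exact (hstrict u v h1 h hv).le
        · rw [h]
      · rw [hx.2.1 u h1.le, ← hx.2.1 0 le_rfl]
        exact (hstrict 0 v le_rfl h0 hv).le
  have hXc : Continuous fun t => x (min t ρ) := hx.1.comp (continuous_id.min continuous_const)
  have hψc : Continuous fun t => ψ (max t 0) :=
    hψ.1.comp_continuous (continuous_id.max continuous_const) fun t => mem_Ici.mpr (le_max_right _ _)
  set F : ℝ → ℝ := fun s => max (x (min (ρ + s - τ) ρ)) (ψ (max s 0)) with hF
  have hFc : Continuous F :=
    (hXc.comp ((continuous_const.add continuous_id).sub continuous_const)).max hψc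
  -- integral equation on `[0, τ]`
  have hint1 : ∀ t ∈ Icc 0 τ, ψ t = ∫ s in (0:ℝ)..t, F s := by
    intro t ht
    rw [hψ.2.2.1 t ht]
    refine intervalIntegral.integral_congr fun s hs => ?_
    rw [uIcc_of_le ht.1] at hs
    simp only [hF]
    rw [min_eq_left (by linarith [hs.2, ht.2]), max_eq_left hs.1]
  have hFnn : ∀ s, 0 ≤ F s := fun s => le_max_of_le_left (hnn _ (min_le_right _ _))
  have hψτ : 0 ≤ ψ τ := by
    rw [hint1 τ ⟨hτ0.le, le_rfl⟩]
    exact intervalIntegral.integral_nonneg hτ0.le fun s _ => hFnn s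
  -- nonnegativity beyond `τ`
  have hψd : ∀ t > τ, HasDerivAt ψ (ψ t) t := by
    intro t ht
    have h : HasDerivAt (fun u => ψ τ + ∫ s in τ..u, ψ (max s 0)) (ψ (max t 0)) t :=
      (hψc.integral_hasStrictDerivAt τ t).hasDerivAt.const_add _
    rw [max_eq_left (hτ0.trans ht).le] at h
    refine h.congr_of_eventuallyEq ?_
    filter_upwards [lt_mem_nhds ht] with u hu
    rw [hψ.2.2.2 u hu.le]
    congr 1
    refine intervalIntegral.integral_congr fun s hs => ?_
    rw [uIcc_of_le hu.le] at hs
    rw [max_eq_left (hτ0.le.trans hs.1)]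
  have hψexp : ∀ t ≥ τ, 0 ≤ ψ t := by
    intro t ht
    rcases ht.lt_or_eq with h | h
    swap
    · rw [← h]; exact hψτ
    have hd : ∀ s > τ, HasDerivAt (fun s => Real.exp (-s) * ψ s) 0 s := by
      intro s hs
      have h1 : HasDerivAt (fun s : ℝ => Real.exp (-s)) (-Real.exp (-s)) s := by
        simpa using (hasDerivAt_neg s).exp
      exact (h1.mul (hψd s hs)).congr_deriv (by ring)
    have hcont : ContinuousOn (fun s => Real.exp (-s) * ψ s) (Icc τ t) :=
      (Real.continuous_exp.comp continuous_neg).continuousOn.mul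
        (hψ.1.mono fun s hs => hτ0.le.trans hs.1)
    have hconst : MonotoneOn (fun s => Real.exp (-s) * ψ s) (Icc τ t) := by
      refine monotoneOn_of_deriv_nonneg (convex_Icc _ _) hcont ?_ ?_
      · intro s hs
        rw [interior_Icc] at hs
        exact (hd s hs.1).differentiableAt.differentiableWithinAt
      · intro s hs
        rw [interior_Icc] at hs
        rw [(hd s hs.1).deriv]
    have h1 := hconst (left_mem_Icc.mpr ht) (right_mem_Icc.mpr ht) ht
    simp only at h1
    have h2 : 0 ≤ Real.exp (-t) * ψ t := le_trans (mul_nonneg (Real.exp_pos _).le hψτ) h1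
    exact nonneg_of_mul_nonneg_right h2 (Real.exp_pos _)
  have hint2 : ∀ t ≥ 0, ψ t = ∫ s in (0:ℝ)..t, F s := by
    intro t ht
    rcases le_total t τ with h | h
    · exact hint1 t ⟨ht, h⟩
    rw [hψ.2.2.2 t h, hint1 τ ⟨hτ0.le, le_rfl⟩,
      ← intervalIntegral.integral_add_adjacent_intervals (hFc.intervalIntegrable 0 τ)
        (hFc.intervalIntegrable τ t)]
    congr 1
    refine intervalIntegral.integral_congr fun s hs => ?_
    rw [uIcc_of_le h] at hs
    simp only [hF]
    rw [min_eq_right (by linarith [hs.1]), max_eq_left (hτ0.le.trans hs.1), hxρ,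
      max_eq_right (hψexp s hs.1)]
  have hstep : ∀ u v, 0 ≤ u → u ≤ v → ψ v = ψ u + ∫ s in u..v, F s := by
    intro u v hu huv
    rw [hint2 v (hu.trans huv), hint2 u hu, intervalIntegral.integral_add_adjacent_intervals
      (hFc.intervalIntegrable 0 u) (hFc.intervalIntegrable u v)]
  have hψmono : ∀ u v, 0 ≤ u → u ≤ v → ψ u ≤ ψ v := by
    intro u v hu huv
    rw [hstep u v hu huv]
    linarith [intervalIntegral.integral_nonneg (μ := volume) huv fun s _ => hFnn s]
  have hψ0 : ψ 0 = 0 := hψ.2.1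
  have hψpos' : ∀ t > 0, 0 < ψ t := by
    intro t ht
    have h1 : 0 < min t τ := lt_min ht hτ0
    refine lt_of_lt_of_le ?_ (hψmono (min t τ) t h1.le (min_le_left _ _))
    rw [hint2 _ h1.le]
    refine intervalIntegral.intervalIntegral_pos_of_pos_on (hFc.intervalIntegrable _ _)
      (fun s hs => lt_max_of_lt_left ?_) h1
    refine hpos _ (min_lt_of_left_lt ?_)
    linarith [hs.2, min_le_right t τ]
  have hFpos : ∀ s > 0, 0 < F s := fun s hs => by
    refine lt_max_of_lt_right ?_
    rw [max_eq_left (le_of_lt hs)]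
    exact hψpos' s hs
  have hψstrict : ∀ u v, 0 ≤ u → u < v → ψ u < ψ v := by
    intro u v hu huv
    rw [hstep u v hu huv.le]
    have : 0 < ∫ s in u..v, F s :=
      intervalIntegral.intervalIntegral_pos_of_pos_on (hFc.intervalIntegrable _ _)
        (fun s hs => hFpos s (hu.trans_lt hs.1)) huv
    linarith
  have hL : 0 < Λ - ρ := by linarith [hΛ.1]
  have hρ1 : 1 ≤ ρ := by
    have h1 := hx.2.2 ρ hρ0.le
    have h2 : ∫ s in (0:ℝ)..ρ, x (s - τ) ≤ ∫ s in (0:ℝ)..ρ, (1:ℝ) := by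
      refine intervalIntegral.integral_mono_on hρ0.le (hcx.intervalIntegrable _ _) (by simp)
        fun s hs => ?_
      rcases le_total (s - τ) 0 with h | h
      · rw [hx.2.1 _ h]
      · rw [← hx.2.1 0 le_rfl]
        exact hanti _ _ h (by linarith [hs.2])
    rw [intervalIntegral.integral_const, smul_eq_mul] at h2
    rw [hxρ] at h1
    linarith
  refine ⟨hτ0, hρ0, hL, ?_, hXc, ?_, ?_, ?_, ?_, ?_, hψc, ?_, ?_, ?_, ?_, ?_⟩
  · by_contra hcon
    have h1 : ψ (Λ - ρ) ≤ ∫ s in (0:ℝ)..(Λ - ρ), (1:ℝ) := by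
      rw [hint2 _ hL.le]
      refine intervalIntegral.integral_mono_on hL.le (hFc.intervalIntegrable _ _) (by simp)
        fun s hs => max_le ?_ ?_
      · refine (hanti (min (min (ρ + s - τ) ρ) 0) _ (min_le_left _ _) (min_le_right _ _)).trans ?_
        rw [hx.2.1 _ (min_le_right _ _)]
      · rw [max_eq_left hs.1, ← hΛ.2]
        exact hψmono _ _ hs.1 hs.2
    rw [hΛ.2, intervalIntegral.integral_const, smul_eq_mul] at h1
    linarith [hτ.2]
  · intro u v huv
    exact hanti _ _ (min_le_min_right _ huv) (min_le_right _ _)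
  · intro u hu v hv huv
    simp only
    rw [min_eq_left hu.2, min_eq_left hv.2]
    exact hstrict u v hu.1 huv hv.2
  · intro t ht
    exact hx.2.1 _ ((min_le_left _ _).trans ht)
  · intro t ht
    rw [min_eq_right ht, hxρ]
  · intro u v hu huv hv
    rw [min_eq_left hv, min_eq_left (huv.trans hv), hx.eq_sub_integral hu (hu.trans huv)]
    congr 1
    refine intervalIntegral.integral_congr fun s hs => ?_
    rw [uIcc_of_le huv] at hs
    rw [min_eq_left (by linarith [hs.2])]
  · intro u v huv
    exact hψmono _ _ (le_max_right _ _) (max_le_max_right _ huv)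
  · intro u hu v hv huv
    simp only
    rw [max_eq_left hu, max_eq_left hv]
    exact hψstrict u v hu huv
  · intro t ht
    rw [max_eq_right ht, hψ0]
  · intro u v hu huv
    rw [max_eq_left hu, max_eq_left (hu.trans huv)]
    exact hstep u v hu huv
  · rw [max_eq_left hL.le, hΛ.2]

/-- A nonnegative function whose slope is controlled after time `T` by its values on the preceding
window of length `τ`, and whose zero-free intervals after `T` have length at most `Λ`. -/
structure WindowSystem (τ Λ T : ℝ) (y : ℝ → ℝ) : Prop where
  cont : Continuous y
  nonneg : ∀ t, 0 ≤ y t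
  slope : ∀ s t, T ≤ s → s ≤ t → ∀ B : ℝ → ℝ, Continuous B →
    (∀ v ∈ Icc s t, ∀ r ∈ Icc (v - τ) v, y r ≤ B v) → |y t - y s| ≤ ∫ v in s..t, B v
  osc : ∀ a b, T ≤ a → a < b → (∀ t ∈ Ioo a b, y t ≠ 0) → b - a ≤ Λ

section Comparison

variable {τ ρ L Λ T : ℝ} {X ψ y : ℝ → ℝ}

theorem Profile.X_nonneg (P : Profile τ ρ L X ψ) (t : ℝ) : 0 ≤ X t := by
  rw [← P.X_of_ge (max t ρ) (le_max_right _ _)]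
  exact P.X_anti (le_max_left _ _)

theorem Profile.X_le_one (P : Profile τ ρ L X ψ) (t : ℝ) : X t ≤ 1 := by
  rw [← P.X_of_nonpos (min t 0) (min_le_right _ _)]
  exact P.X_anti (min_le_left _ _)

theorem Profile.X_pos (P : Profile τ ρ L X ψ) {t : ℝ} (ht : t < ρ) : 0 < X t := by
  rcases le_total t 0 with h | h
  · rw [P.X_of_nonpos t h]; exact one_pos
  · rw [← P.X_of_ge ρ le_rfl]
    exact P.X_strict ⟨h, ht.le⟩ ⟨P.ρ_pos.le, le_rfl⟩ ht

theorem Profile.X_lt_one (P : Profile τ ρ L X ψ) {t : ℝ} (ht : 0 < t) : X t < 1 := by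
  have h1 : 0 < min t ρ := lt_min ht P.ρ_pos
  refine (P.X_anti (min_le_left t ρ)).trans_lt ?_
  rw [← P.X_of_nonpos 0 le_rfl]
  exact P.X_strict ⟨le_rfl, P.ρ_pos.le⟩ ⟨h1.le, min_le_right _ _⟩ h1

theorem Profile.X_le_imp (P : Profile τ ρ L X ψ) {u v : ℝ} (hu : 0 ≤ u) (hu' : u < ρ)
    (h : X u ≤ X v) : v ≤ u := by
  by_contra hn
  push Not at hn
  have h1 : u < min v ρ := lt_min hn hu'
  have h2 := P.X_strict ⟨hu, hu'.le⟩ ⟨hu.trans h1.le, min_le_right _ _⟩ h1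
  linarith [P.X_anti (min_le_left v ρ)]

theorem Profile.ψ_nonneg (P : Profile τ ρ L X ψ) (t : ℝ) : 0 ≤ ψ t := by
  rw [← P.ψ_of_nonpos (min t 0) (min_le_right _ _)]
  exact P.ψ_mono (min_le_left _ _)

theorem Profile.rate_cont (P : Profile τ ρ L X ψ) :
    Continuous fun s => max (X (ρ + s - τ)) (ψ s) :=
  (P.X_cont.comp ((continuous_const.add continuous_id).sub continuous_const)).max P.ψ_cont

theorem Profile.X_shift_cont (P : Profile τ ρ L X ψ) (k : ℝ) :
    Continuous fun s => X (s - k) :=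
  P.X_cont.comp (continuous_id.sub continuous_const)

theorem Profile.lt_of_one_lt_ψ (P : Profile τ ρ L X ψ) {t : ℝ} (h : 1 < ψ t) : L < t := by
  by_contra hn
  push Not at hn
  linarith [P.ψ_mono hn, P.ψ_L]

theorem Profile.le_of_one_le_ψ (P : Profile τ ρ L X ψ) {t : ℝ} (h : 1 ≤ ψ t) : L ≤ t := by
  by_contra hn
  push Not at hn
  rcases le_total t 0 with h0 | h0
  · rw [P.ψ_of_nonpos t h0] at h
    linarith
  · linarith [P.ψ_strict h0 P.L_pos.le hn, P.ψ_L]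

theorem WindowSystem.mono {T' : ℝ} (W : WindowSystem τ Λ T y) (h : T ≤ T') :
    WindowSystem τ Λ T' y :=
  ⟨W.cont, W.nonneg, fun s t hs => W.slope s t (h.trans hs), fun a b ha => W.osc a b (h.trans ha)⟩

/-- Fastest-decay comparison: a function bounded by `m` cannot run down the profile `m X` faster
than with unit speed. -/
theorem WindowSystem.decay (W : WindowSystem τ Λ T y) (P : Profile τ ρ L X ψ) {c d m u : ℝ}
    (hTc : T ≤ c) (hcd : c ≤ d) (hm : 0 < m) (hle : ∀ r ∈ Icc (c - τ) d, y r ≤ m)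
    (hu0 : 0 ≤ u) (huρ : u ≤ ρ) (hyd : y d ≤ m * X u) (hc : y c = m ∨ u ≤ d - c) :
    u ≤ d - c ∧ ∀ s ∈ Icc c d, y s ≤ m * X (s - d + u) := by
  set δ₀ := max 0 (c - d + u) with hδ₀
  have hδu : δ₀ ≤ u := max_le hu0 (by linarith)
  have hτ := P.τ_pos
  let K : Set (ℝ × ℝ) := (Icc c d ×ˢ Icc δ₀ u) ∩
    ({q | 0 ≤ q.1 - d + u - q.2} ∩ {q | m * X (q.1 - d + u - q.2) ≤ y q.1})
  have hargc : Continuous fun q : ℝ × ℝ => q.1 - d + u - q.2 := by fun_prop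
  have hKc : IsCompact K := by
    refine (isCompact_Icc.prod isCompact_Icc).inter_right (IsClosed.inter ?_ ?_)
    · exact isClosed_le continuous_const hargc
    · exact isClosed_le (continuous_const.mul (P.X_cont.comp hargc)) (W.cont.comp continuous_fst)
  have hcy : 0 < δ₀ → (c, δ₀) ∈ K := by
    intro h
    have h1 : δ₀ = c - d + u := by
      rcases max_choice 0 (c - d + u) with h2 | h2
      · rw [hδ₀, h2] at h; exact absurd h (lt_irrefl _)
      · rw [hδ₀, h2]
    have h2 : c - d + u - δ₀ = 0 := by linarith
    refine ⟨⟨⟨le_rfl, hcd⟩, ⟨le_rfl, hδu⟩⟩, ?_, ?_⟩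
    · change 0 ≤ c - d + u - δ₀
      rw [h2]
    · change m * X (c - d + u - δ₀) ≤ y c
      rw [h2, P.X_of_nonpos 0 le_rfl, mul_one]
      rcases hc with hc | hc
      · exact hc.ge
      · linarith
  have hres : δ₀ = 0 → u ≤ d - c := fun h => by
    have := le_max_right 0 (c - d + u)
    rw [← hδ₀, h] at this
    linarith
  rcases K.eq_empty_or_nonempty with hK | hK
  · have h0 : δ₀ = 0 := by
      by_contra hne
      have h1 := hcy (lt_of_le_of_ne (le_max_left _ _) (Ne.symm hne))
      rw [hK] at h1
      exact h1
    refine ⟨hres h0, fun s hs => ?_⟩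
    rcases le_total (s - d + u) 0 with h1 | h1
    · rw [P.X_of_nonpos _ h1, mul_one]
      exact hle s ⟨by linarith [hs.1], hs.2⟩
    · by_contra hn
      push Not at hn
      have : (s, δ₀) ∈ K := by
        refine ⟨⟨hs, ⟨le_rfl, hδu⟩⟩, ?_, ?_⟩
        · change 0 ≤ s - d + u - δ₀
          rw [h0]; linarith
        · change m * X (s - d + u - δ₀) ≤ y s
          rw [h0, sub_zero]; exact hn.le
      rw [hK] at this
      exact this
  · obtain ⟨⟨s₁, δ⟩, ⟨⟨hs₁, hδ⟩, harg, htouch⟩, hmax⟩ :=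
      hKc.exists_isMaxOn hK continuous_snd.continuousOn
    simp only at hs₁ hδ
    change 0 ≤ s₁ - d + u - δ at harg
    change m * X (s₁ - d + u - δ) ≤ y s₁ at htouch
    have hbound : ∀ s ∈ Icc c d, y s ≤ m * X (s - d + u - δ) := by
      intro s hs
      by_contra hn
      push Not at hn
      have hpos : 0 < s - d + u - δ := by
        by_contra h
        push Not at h
        rw [P.X_of_nonpos _ h, mul_one] at hn
        linarith [hle s ⟨by linarith [hs.1], hs.2⟩]
      have hev : ∀ᶠ e in nhds (0:ℝ), m * X (s - d + u - (δ + e)) < y s := by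
        have hcont : Continuous fun e : ℝ => m * X (s - d + u - (δ + e)) :=
          continuous_const.mul (P.X_cont.comp (by fun_prop))
        refine (hcont.tendsto 0).eventually_lt_const ?_
        simpa using hn
      obtain ⟨e, he, he0, he1⟩ := ((hev.filter_mono nhdsWithin_le_nhds).and
        (Ioo_mem_nhdsGT hpos)).exists
      have hmem : (s, δ + e) ∈ K := by
        refine ⟨⟨hs, ⟨?_, ?_⟩⟩, ?_, ?_⟩
        · change δ₀ ≤ δ + e
          linarith [hδ.1]
        · change δ + e ≤ u
          linarith [hs.2]
        · change 0 ≤ s - d + u - (δ + e)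
          linarith
        · exact he.le
      have := hmax hmem
      change δ + e ≤ δ at this
      linarith
    have hcδ : c - d + u ≤ δ := (le_max_right _ _).trans hδ.1
    have hslope := W.slope s₁ d (hTc.trans hs₁.1) hs₁.2
      (fun v => m * X (v - (d - u + δ + τ))) (continuous_const.mul (P.X_shift_cont _)) (by
        intro v hv r hr
        rcases le_or_gt c r with hcr | hcr
        · refine (hbound r ⟨hcr, hr.2.trans hv.2⟩).trans (mul_le_mul_of_nonneg_left ?_ hm.le)
          exact P.X_anti (by linarith [hr.1])
        · rw [P.X_of_nonpos _ (by linarith [hr.1]), mul_one]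
          exact hle r ⟨by linarith [hr.1, hv.1, hs₁.1], by linarith⟩)
    rw [intervalIntegral.integral_const_mul] at hslope
    have hX := P.X_step (s₁ - d + u - δ) (u - δ) harg (by linarith [hs₁.2]) (by
      linarith [hδ.1, le_max_left (0:ℝ) (c - d + u)])
    have hsub : (∫ s in (s₁ - d + u - δ)..(u - δ), X (s - τ))
        = ∫ v in s₁..d, X (v - (d - u + δ + τ)) := by
      have := intervalIntegral.integral_comp_sub_right (a := s₁) (b := d) (fun s => X (s - τ))
        (d - u + δ)
      simp only [sub_sub] at this
      rw [this]
      congr 1 <;> ring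
    rw [hsub] at hX
    have h1 := (abs_le.mp hslope).1
    have h2 : m * X (u - δ) ≤ m * X u := by
      rw [hX, mul_sub]
      linarith
    have hδ0 : 0 ≤ δ := (le_max_left _ _).trans hδ.1
    have h3 : δ = 0 := by
      by_contra hne
      have hlt : 0 < δ := lt_of_le_of_ne hδ0 (Ne.symm hne)
      have h4 := P.X_strict ⟨by linarith [hδ.2], by linarith⟩ ⟨hu0, huρ⟩
        (by linarith : u - δ < u)
      linarith [le_of_mul_le_mul_left h2 hm]
    refine ⟨hres (le_antisymm (h3 ▸ hδ.1) (le_max_left _ _)), fun s hs => ?_⟩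
    have := hbound s hs
    rwa [h3, sub_zero] at this

/-- Before a zero, a function bounded by `m` lies below the profile `m X`. -/
theorem WindowSystem.le_before_zero (W : WindowSystem τ Λ T y) (P : Profile τ ρ L X ψ)
    {a m : ℝ} (hT : T ≤ a - ρ) (hm : 0 < m) (ha : y a = 0)
    (hle : ∀ r ∈ Icc (a - ρ - τ) a, y r ≤ m) :
    ∀ r ∈ Icc (a - ρ - τ) a, y r ≤ m * X (ρ - (a - r)) := by
  intro r hr
  have hρ := P.ρ_pos
  rcases le_total (a - ρ) r with h | h
  · have := (W.decay P (c := a - ρ) (d := a) (u := ρ) hT (by linarith) hm hle hρ.le le_rfl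
      (by rw [ha, P.X_of_ge ρ le_rfl, mul_zero]) (Or.inr (by linarith))).2 r ⟨h, hr.2⟩
    rwa [show r - a + ρ = ρ - (a - r) by ring] at this
  · rw [P.X_of_nonpos _ (by linarith), mul_one]
    exact hle r hr

/-- Fastest-growth comparison after a zero. -/
theorem WindowSystem.growth (W : WindowSystem τ Λ T y) (P : Profile τ ρ L X ψ)
    {a m : ℝ} (hT : T ≤ a) (hm : 0 < m) (ha : y a = 0)
    (hle : ∀ r ∈ Icc (a - τ) a, y r ≤ m * X (ρ - (a - r))) :
    ∀ t, 0 ≤ t → y (a + t) ≤ m * ψ t := by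
  have key : ∀ ε > 0, ∀ t, 0 ≤ t → y (a + t) < m * ψ t + ε * Real.exp (2 * t) := by
    intro ε hε
    set φ : ℝ → ℝ := fun t => m * ψ t + ε * Real.exp (2 * t) with hφ
    have hφc : Continuous φ := (continuous_const.mul P.ψ_cont).add (by fun_prop)
    have hφm : Monotone φ := by
      intro s t hst
      have h1 := mul_le_mul_of_nonneg_left (P.ψ_mono hst) hm.le
      have h2 : Real.exp (2 * s) ≤ Real.exp (2 * t) := Real.exp_le_exp.mpr (by linarith)
      have h3 := mul_le_mul_of_nonneg_left h2 hε.le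
      simp only [hφ]
      linarith
    have hyc : Continuous fun t => y (a + t) := W.cont.comp (by fun_prop)
    by_contra hn
    push Not at hn
    let Z : Set ℝ := Ici 0 ∩ {t | φ t ≤ y (a + t)}
    have hZc : IsClosed Z := isClosed_Ici.inter (isClosed_le hφc hyc)
    have hZb : BddBelow Z := ⟨0, fun t ht => ht.1⟩
    obtain ⟨t', ht', ht''⟩ := hn
    have hmem : sInf Z ∈ Z := hZc.csInf_mem ⟨t', ht', ht''⟩ hZb
    set t := sInf Z with ht
    have ht0 : 0 ≤ t := hmem.1
    have hlt : ∀ s, 0 ≤ s → s < t → y (a + s) ≤ φ s := by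
      intro s hs hst
      by_contra hcon
      push Not at hcon
      exact absurd (csInf_le hZb ⟨hs, hcon.le⟩) (not_le.mpr hst)
    have hlt' : ∀ s, 0 ≤ s → s ≤ t → y (a + s) ≤ φ s := by
      intro s hs hst
      rcases hst.lt_or_eq with h | h
      · exact hlt s hs h
      rcases hs.lt_or_eq with h0 | h0
      · have hcl : IsClosed {s | y (a + s) ≤ φ s} := isClosed_le hyc hφc
        have hsub : Ico 0 s ⊆ {s | y (a + s) ≤ φ s} := fun v hv => hlt v hv.1 (h ▸ hv.2)
        have := hcl.closure_subset_iff.mpr hsub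
        rw [closure_Ico h0.ne] at this
        exact this ⟨h0.le, le_rfl⟩
      · rw [← h0, add_zero, ha]
        simp only [hφ]
        have := mul_nonneg hm.le (P.ψ_nonneg 0)
        positivity
    set B : ℝ → ℝ := fun v => m * max (X (ρ + (v - a) - τ)) (ψ (v - a))
      + ε * Real.exp (2 * (v - a)) with hB
    have hBc : Continuous B := by
      refine (continuous_const.mul ?_).add (by fun_prop)
      exact P.rate_cont.comp (continuous_id.sub continuous_const)
    have hslope := W.slope a (a + t) hT (by linarith) B hBc (by
      intro v hv r hr
      rcases le_total a r with h | h
      · have h1 := hlt' (r - a) (by linarith) (by linarith [hr.2, hv.2])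
        rw [add_sub_cancel] at h1
        refine h1.trans ((hφm (by linarith [hr.2] : r - a ≤ v - a)).trans ?_)
        simp only [hφ, hB]
        have := mul_le_mul_of_nonneg_left (le_max_right (X (ρ + (v - a) - τ)) (ψ (v - a))) hm.le
        linarith
      · refine (hle r ⟨by linarith [hr.1, hv.1], h⟩).trans ?_
        have h1 : X (ρ - (a - r)) ≤ max (X (ρ + (v - a) - τ)) (ψ (v - a)) :=
          (P.X_anti (by linarith [hr.1])).trans (le_max_left _ _)
        have h2 := mul_le_mul_of_nonneg_left h1 hm.le
        have h3 : 0 ≤ ε * Real.exp (2 * (v - a)) := by positivity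
        simp only [hB]
        linarith)
    have hshift : ∫ v in a..(a + t), B v
        = ∫ s in (0:ℝ)..t, (m * max (X (ρ + s - τ)) (ψ s) + ε * Real.exp (2 * s)) := by
      have := intervalIntegral.integral_comp_sub_right (a := a) (b := a + t)
        (fun s => m * max (X (ρ + s - τ)) (ψ s) + ε * Real.exp (2 * s)) a
      rw [sub_self, add_sub_cancel_left] at this
      exact this
    have hexp : ∫ s in (0:ℝ)..t, Real.exp (2 * s) = (Real.exp (2 * t) - 1) / 2 := by
      rw [intervalIntegral.integral_comp_mul_left (fun s => Real.exp s) (two_ne_zero)]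
      simp
      ring
    have hrc : Continuous fun s => m * max (X (ρ + s - τ)) (ψ s) :=
      continuous_const.mul P.rate_cont
    rw [hshift, intervalIntegral.integral_add
      (hrc.intervalIntegrable _ _)
      ((by fun_prop : Continuous fun s : ℝ => ε * Real.exp (2 * s)).intervalIntegrable _ _),
      intervalIntegral.integral_const_mul, intervalIntegral.integral_const_mul, hexp, ha,
      sub_zero] at hslope
    have h1 := P.ψ_step 0 t le_rfl ht0
    rw [P.ψ_of_nonpos 0 le_rfl, zero_add] at h1
    rw [← h1] at hslope
    have h2 := (le_abs_self _).trans hslope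
    have h3 : φ t ≤ y (a + t) := hmem.2
    simp only [hφ] at h3
    have h4 : 0 < ε * Real.exp (2 * t) := by positivity
    nlinarith
  intro t ht
  refine le_of_forall_pos_le_add fun ε hε => ?_
  have h := key (ε / Real.exp (2 * t)) (by positivity) t ht
  rw [div_mul_cancel₀ _ (Real.exp_pos _).ne'] at h
  exact h.le

end Comparison

section Zeros

variable {τ ρ L Λ T : ℝ} {X ψ y : ℝ → ℝ}

theorem WindowSystem.exists_zero (W : WindowSystem τ Λ T y) (hΛ : 0 < Λ) {t : ℝ} (ht : T ≤ t) :
    ∃ z ∈ Icc t (t + Λ + 1), y z = 0 := by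
  by_contra hn
  push Not at hn
  have := W.osc t (t + Λ + 1) ht (by linarith) fun r hr => hn r ⟨hr.1.le, hr.2.le⟩
  linarith

/-- A time `c` at which `y` is positive lies in a zero-free interval with zeros as endpoints. -/
theorem WindowSystem.exists_nodal (W : WindowSystem τ Λ T y) (hΛ : 0 < Λ) {z c : ℝ} (hz : T ≤ z)
    (hzc : z ≤ c) (hyz : y z = 0) (hc : 0 < y c) :
    ∃ a b, z ≤ a ∧ a < c ∧ c < b ∧ y a = 0 ∧ y b = 0 ∧ (∀ r ∈ Ioo a b, y r ≠ 0) ∧ b - a ≤ Λ := by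
  have hcl : IsClosed (y ⁻¹' {0}) := isClosed_singleton.preimage W.cont
  let A : Set ℝ := Icc z c ∩ y ⁻¹' {0}
  let B : Set ℝ := Ici c ∩ y ⁻¹' {0}
  have hA : sSup A ∈ A := (isCompact_Icc.inter_right hcl).sSup_mem ⟨z, ⟨le_rfl, hzc⟩, hyz⟩
  have hAb : BddAbove A := ⟨c, fun r hr => hr.1.2⟩
  obtain ⟨z', hz', hyz'⟩ := W.exists_zero hΛ (hz.trans hzc)
  have hBb : BddBelow B := ⟨c, fun r hr => hr.1⟩
  have hB : sInf B ∈ B := (isClosed_Ici.inter hcl).csInf_mem ⟨z', hz'.1, hyz'⟩ hBb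
  have hne : ∀ r, y r = 0 → r ≠ c := fun r hr h => by rw [h] at hr; linarith
  have hfree : ∀ r ∈ Ioo (sSup A) (sInf B), y r ≠ 0 := by
    intro r hr h
    rcases le_total r c with h1 | h1
    · exact absurd (le_csSup hAb ⟨⟨hA.1.1.trans hr.1.le, h1⟩, h⟩) (not_le.mpr hr.1)
    · exact absurd (csInf_le hBb ⟨h1, h⟩) (not_le.mpr hr.2)
  have h1 : sSup A < c := lt_of_le_of_ne hA.1.2 (hne _ hA.2)
  have h2 : c < sInf B := lt_of_le_of_ne hB.1 (hne _ hB.2).symm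
  exact ⟨sSup A, sInf B, hA.1.1, h1, h2, hA.2, hB.2, hfree,
    W.osc _ _ (hz.trans hA.1.1) (h1.trans h2) hfree⟩

/-- A bound on a window of length `ρ + τ` before a zero persists for all later times. -/
theorem WindowSystem.stays_below (W : WindowSystem τ (ρ + L) T y) (P : Profile τ ρ L X ψ)
    {z S : ℝ} (hT : T ≤ z - ρ) (hS : 0 < S) (hz : y z = 0)
    (hle : ∀ r ∈ Icc (z - ρ - τ) z, y r ≤ S) : ∀ t ≥ z, y t ≤ S := by
  have hρ := P.ρ_pos
  have hL := P.L_pos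
  have hτ := P.τ_pos
  by_contra hn
  push Not at hn
  obtain ⟨t, htz, hyt⟩ := hn
  let A : Set ℝ := {r | z ≤ r ∧ S < y r}
  have hAb : BddBelow A := ⟨z, fun r hr => hr.1⟩
  have hAne : A.Nonempty := ⟨t, htz, hyt⟩
  set q := sInf A with hq
  have hzq : z ≤ q := le_csInf hAne fun r hr => hr.1
  have hbefore : ∀ r, z ≤ r → r < q → y r ≤ S := by
    intro r hr hrq
    by_contra h
    push Not at h
    exact absurd (csInf_le hAb ⟨hr, h⟩) (not_le.mpr hrq)
  have hyq : S ≤ y q := by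
    have h1 : q ∈ closure A := csInf_mem_closure hAne hAb
    have h2 : A ⊆ {r | S ≤ y r} := fun r hr => hr.2.le
    exact (isClosed_le continuous_const W.cont).closure_subset_iff.mpr h2 h1
  obtain ⟨a, b, hza, haq, hqb, hya, hyb, hfree, hlen⟩ :=
    W.exists_nodal (by linarith) (by linarith : T ≤ z) hzq hz (by linarith)
  obtain ⟨r, hrA, hrb⟩ := exists_lt_of_csInf_lt hAne hqb
  have har : a < r := haq.trans_le (csInf_le hAb hrA)
  obtain ⟨c, hc, hmax⟩ := isCompact_Icc.exists_isMaxOn (nonempty_Icc.mpr (haq.trans hqb).le)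
    W.cont.continuousOn
  have hm : S < y c := hrA.2.trans_le (hmax ⟨har.le, hrb.le⟩)
  have hpast : ∀ v ∈ Icc (z - ρ - τ) a, y v ≤ S := by
    intro v hv
    rcases le_total v z with h | h
    · exact hle v ⟨hv.1, h⟩
    · exact hbefore v h (hv.2.trans_lt haq)
  have hpast' : ∀ v ∈ Icc (z - ρ - τ) b, y v ≤ y c := by
    intro v hv
    rcases le_total v a with h | h
    · exact (hpast v ⟨hv.1, h⟩).trans hm.le
    · exact hmax ⟨h, hv.2⟩
  have hgr := W.growth P (by linarith : T ≤ a) hS hya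
    (fun v hv => W.le_before_zero P (by linarith) hS hya
      (fun w hw => hpast w ⟨by linarith [hw.1], hw.2⟩) v ⟨by linarith [hv.1], hv.2⟩)
    (c - a) (by linarith [hc.1])
  rw [add_sub_cancel] at hgr
  have h1 : L < c - a := P.lt_of_one_lt_ψ (by
    by_contra h
    push Not at h
    nlinarith)
  have h2 := (W.decay P (c := c) (d := b) (u := ρ) (by linarith [hc.1]) hc.2 (hS.trans hm)
    (fun v hv => hpast' v ⟨by linarith [hv.1, hc.1], hv.2⟩) hρ.le le_rfl
    (by rw [hyb, P.X_of_ge ρ le_rfl, mul_zero]) (Or.inl rfl)).1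
  linarith

/-- If the increments of `y` after `t` are at least those of a primitive of `f`, then the window
before `t` contains a value at least `f t`. -/
theorem WindowSystem.exists_ge_of_slope (W : WindowSystem τ Λ T y) (hτ : 0 ≤ τ) {t h₀ : ℝ}
    {f : ℝ → ℝ} (ht : T ≤ t) (hf : Continuous f) (hh₀ : 0 < h₀)
    (h : ∀ e ∈ Ioc 0 h₀, ∫ v in t..(t + e), f v ≤ |y (t + e) - y t|) :
    ∃ r ∈ Icc (t - τ) t, f t ≤ y r := by
  by_contra hn
  push Not at hn
  obtain ⟨r₀, hr₀, hmax⟩ := isCompact_Icc.exists_isMaxOn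
    (nonempty_Icc.mpr (by linarith : t - τ ≤ t)) W.cont.continuousOn
  obtain ⟨ν, hν1, hν2⟩ := exists_between (hn r₀ hr₀)
  have hyt : y t < ν := (hmax (right_mem_Icc.mpr (by linarith))).trans_lt hν1
  have hev : ∀ᶠ v in nhds t, y v < ν ∧ ν < f v :=
    ((W.cont.tendsto t).eventually_lt_const hyt).and ((hf.tendsto t).eventually_const_lt hν2)
  obtain ⟨δ, hδ, hball⟩ := Metric.eventually_nhds_iff.mp hev
  set e := min h₀ (δ / 2) with he
  have he0 : 0 < e := lt_min hh₀ (by linarith)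
  have hnear : ∀ v ∈ Icc t (t + e), y v < ν ∧ ν < f v := by
    intro v hv
    refine hball ?_
    rw [Real.dist_eq, abs_of_nonneg (by linarith [hv.1])]
    linarith [hv.2, min_le_right h₀ (δ / 2)]
  have h1 := W.slope t (t + e) ht (by linarith) (fun _ => ν) continuous_const (by
    intro v hv r hr
    rcases le_total r t with hrt | hrt
    · exact (hmax (show r ∈ Icc (t - τ) t from ⟨by linarith [hr.1, hv.1], hrt⟩)).trans hν1.le
    · exact (hnear r ⟨hrt, hr.2.trans hv.2⟩).1.le)
  have h2 := h e ⟨he0, min_le_left _ _⟩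
  have h3 : ∫ v in t..(t + e), ν < ∫ v in t..(t + e), f v := by
    refine intervalIntegral.integral_lt_integral_of_continuousOn_of_le_of_exists_lt (by linarith)
      continuousOn_const hf.continuousOn (fun v hv => (hnear v ⟨hv.1.le, hv.2⟩).2.le)
      ⟨t, ⟨le_rfl, by linarith⟩, (hnear t ⟨le_rfl, by linarith⟩).2⟩
  linarith

theorem Profile.start_lt (P : Profile τ ρ L X ψ) : max 0 (τ - ρ) < L :=
  max_lt P.L_pos (by linarith [P.τ_lt])

/-- At the critical time `max 0 (τ - ρ)` the growth of `ψ` is driven by the decay profile. -/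
theorem Profile.ψ_start_lt (P : Profile τ ρ L X ψ) :
    ψ (max 0 (τ - ρ)) < X (ρ + max 0 (τ - ρ) - τ) := by
  rcases le_total (τ - ρ) 0 with h | h
  · rw [max_eq_left h, P.ψ_of_nonpos 0 le_rfl]
    exact P.X_pos (by linarith [P.τ_pos])
  · rw [max_eq_right h, P.X_of_nonpos _ (by linarith), ← P.ψ_L]
    exact P.ψ_strict h P.L_pos.le (by linarith [P.τ_lt])

/-- Rigidity: if `y ≤ M` everywhere and `y` attains `M` after a zero `z`, then `y (z - ρ) = M`. -/
theorem WindowSystem.rigid (W : ∀ T, WindowSystem τ (ρ + L) T y) (P : Profile τ ρ L X ψ)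
    {z M : ℝ} (hM : 0 < M) (hle : ∀ t, y t ≤ M) (hz : y z = 0) (hex : ∃ t ≥ z, y t = M) :
    y (z - ρ) = M := by
  have hρ := P.ρ_pos
  have hL := P.L_pos
  have hτ := P.τ_pos
  have hcont := (W 0).cont
  let A : Set ℝ := Ici z ∩ y ⁻¹' {M}
  have hAb : BddBelow A := ⟨z, fun r hr => hr.1⟩
  obtain ⟨t₁, ht₁, hyt₁⟩ := hex
  have hcA : sInf A ∈ A :=
    (isClosed_Ici.inter (isClosed_singleton.preimage hcont)).csInf_mem ⟨t₁, ht₁, hyt₁⟩ hAb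
  set c := sInf A with hc
  have hyc : y c = M := hcA.2
  obtain ⟨a, b, hza, hac, hcb, hya, hyb, -, hlen⟩ :=
    (W z).exists_nodal (by linarith) le_rfl hcA.1 hz (by rw [hyc]; exact hM)
  have hbefore : ∀ r ≤ a, y r ≤ M * X (ρ - (a - r)) := by
    intro r hr
    rcases le_total (a - ρ) r with h | h
    · exact (W (a - ρ)).le_before_zero P le_rfl hM hya (fun v _ => hle v) r
        ⟨by linarith, hr⟩
    · rw [P.X_of_nonpos _ (by linarith), mul_one]
      exact hle r
  have hgr := (W a).growth P le_rfl hM hya fun r hr => hbefore r hr.2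
  have hca : L = c - a := by
    have h1 := hgr (c - a) (by linarith)
    rw [add_sub_cancel, hyc] at h1
    have h2 : L ≤ c - a := P.le_of_one_le_ψ (by
      by_contra h
      push Not at h
      nlinarith)
    have h3 := ((W c).decay P (c := c) (d := b) (u := ρ) le_rfl hcb.le hM (fun v _ => hle v)
      hρ.le le_rfl (by rw [hyb, P.X_of_ge ρ le_rfl, mul_zero]) (Or.inl hyc)).1
    linarith
  have hwin : ∀ s t, 0 ≤ s → s ≤ t → |y (a + t) - y (a + s)| ≤ M * (ψ t - ψ s) := by
    intro s t hs hst
    have h1 := (W (a + s)).slope (a + s) (a + t) le_rfl (by linarith)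
      (fun v => M * max (X (ρ + (v - a) - τ)) (ψ (v - a)))
      (continuous_const.mul (P.rate_cont.comp (continuous_id.sub continuous_const))) (by
        intro v hv r hr
        rcases le_total r a with h | h
        · refine (hbefore r h).trans (mul_le_mul_of_nonneg_left ?_ hM.le)
          exact (P.X_anti (by linarith [hr.1])).trans (le_max_left _ _)
        · have h2 := hgr (r - a) (by linarith)
          rw [add_sub_cancel] at h2
          refine h2.trans (mul_le_mul_of_nonneg_left ?_ hM.le)
          exact (P.ψ_mono (by linarith [hr.2])).trans (le_max_right _ _))
    have h2 := intervalIntegral.integral_comp_sub_right (a := a + s) (b := a + t)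
      (fun s => M * max (X (ρ + s - τ)) (ψ s)) a
    rw [h2, add_sub_cancel_left, add_sub_cancel_left, intervalIntegral.integral_const_mul] at h1
    rw [P.ψ_step s t hs hst, add_sub_cancel_left]
    exact h1
  have hgeq : ∀ t, 0 ≤ t → t ≤ L → y (a + t) = M * ψ t := by
    intro t ht0 htL
    refine le_antisymm (hgr t ht0) ?_
    have h1 := (le_abs_self _).trans (hwin t L ht0 htL)
    rw [hca, add_sub_cancel, hyc, ← hca, P.ψ_L] at h1
    linarith
  set s₀ := max 0 (τ - ρ) with hs₀
  have hs₀0 : 0 ≤ s₀ := le_max_left _ _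
  have hs₀1 : τ - ρ ≤ s₀ := le_max_right _ _
  have hs₀τ : s₀ < τ := max_lt hτ (by linarith)
  have hs₀L : s₀ < L := P.start_lt
  -- the profile is touched at distance `min τ ρ` before `a`
  have hbase : y (a - (τ - s₀)) = M * X (ρ - (τ - s₀)) := by
    obtain ⟨r, hr, hyr⟩ := (W (a + s₀)).exists_ge_of_slope hτ.le (t := a + s₀) (h₀ := L - s₀)
      (f := fun v => M * X (v - (a - ρ + τ))) le_rfl
      (continuous_const.mul (P.X_shift_cont _)) (by linarith) (by
        intro e he
        rw [hgeq s₀ hs₀0 hs₀L.le, add_assoc, hgeq (s₀ + e) (by linarith [he.1])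
          (by linarith [he.2]), ← mul_sub, P.ψ_step s₀ (s₀ + e) hs₀0 (by linarith [he.1]),
          add_sub_cancel_left]
        refine le_trans ?_ (le_abs_self _)
        rw [intervalIntegral.integral_const_mul]
        refine mul_le_mul_of_nonneg_left ?_ hM.le
        have h2 := intervalIntegral.integral_comp_sub_right (a := a + s₀) (b := a + (s₀ + e))
          (fun s => X (s - (τ - ρ))) a
        rw [add_sub_cancel_left, add_sub_cancel_left] at h2
        have h3 : (∫ v in (a + s₀)..(a + (s₀ + e)), X (v - (a - ρ + τ)))
            = ∫ v in (a + s₀)..(a + (s₀ + e)), X (v - a - (τ - ρ)) := by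
          congr 1; ext v; congr 1; ring
        rw [h3, h2]
        refine intervalIntegral.integral_mono_on (by linarith [he.1])
          ((P.X_shift_cont _).intervalIntegrable _ _) (P.rate_cont.intervalIntegrable _ _) ?_
        intro v _
        rw [show v - (τ - ρ) = ρ + v - τ by ring]
        exact le_max_left _ _)
    rw [show a + s₀ - (a - ρ + τ) = ρ - (τ - s₀) by ring] at hyr
    rcases le_total r a with h | h
    · have h1 := le_of_mul_le_mul_left (hyr.trans (hbefore r h)) hM
      have h2 := P.X_le_imp (by linarith) (by linarith) h1
      have h3 : r = a - (τ - s₀) := by linarith [hr.1]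
      rw [← h3]
      refine le_antisymm ?_ hyr
      have := hbefore r h
      rwa [h3, sub_sub_cancel, ← h3] at this
    · exfalso
      have h1 := hgr (r - a) (by linarith)
      rw [add_sub_cancel] at h1
      have h2 := P.ψ_mono (by linarith [hr.2] : r - a ≤ s₀)
      have h3 := P.ψ_start_lt
      rw [← hs₀, show ρ + s₀ - τ = ρ - (τ - s₀) by ring] at h3
      have h4 := le_of_mul_le_mul_left (hyr.trans h1) hM
      linarith
  -- touching at `a - w` propagates to `[a - w, a]`
  have hseg : ∀ w, 0 ≤ w → w ≤ ρ → y (a - w) = M * X (ρ - w) →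
      ∀ t, 0 ≤ t → t ≤ w → y (a - t) = M * X (ρ - t) := by
    intro w hw0 hwρ hw t ht0 htw
    refine le_antisymm (by simpa using hbefore (a - t) (by linarith)) ?_
    have h1 := (W (a - w)).slope (a - w) (a - t) le_rfl (by linarith)
      (fun v => M * X (v - (a - ρ + τ))) (continuous_const.mul (P.X_shift_cont _)) (by
        intro v hv r hr
        refine (hbefore r (by linarith [hr.2, hv.2])).trans (mul_le_mul_of_nonneg_left ?_ hM.le)
        exact P.X_anti (by linarith [hr.1]))
    have h2 := P.X_step (ρ - w) (ρ - t) (by linarith) (by linarith) (by linarith)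
    have h3 := intervalIntegral.integral_comp_sub_right (a := a - w) (b := a - t)
      (fun s => X (s - τ)) (a - ρ)
    simp only [sub_sub] at h3
    rw [intervalIntegral.integral_const_mul, h3, hw] at h1
    rw [show a - (w + (a - ρ)) = ρ - w by ring, show a - (t + (a - ρ)) = ρ - t by ring] at h1
    have h4 := (abs_le.mp h1).1
    rw [h2, mul_sub]
    linarith
  have hchain : ∀ k : ℕ, y (a - min ((k + 1) * τ) ρ) = M * X (ρ - min ((k + 1) * τ) ρ) := by
    intro k
    induction k with
    | zero =>
      have h1 : min (((0:ℕ) + 1 : ℝ) * τ) ρ = τ - s₀ := by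
        rw [hs₀, Nat.cast_zero, zero_add, one_mul]
        rcases le_total τ ρ with h | h
        · rw [min_eq_left h, max_eq_left (by linarith), sub_zero]
        · rw [min_eq_right h, max_eq_right (by linarith), sub_sub_cancel]
      rw [h1]
      exact hbase
    | succ k ih =>
      rcases le_or_gt ρ ((k + 1) * τ) with hk | hk
      · rw [min_eq_right hk] at ih
        have : ρ ≤ ((k + 1 : ℕ) + 1 : ℝ) * τ := by push_cast; nlinarith
        rw [min_eq_right this]
        exact ih
      · rw [min_eq_left hk.le] at ih
        have hkτ : τ ≤ (k + 1) * τ := by nlinarith [mul_nonneg (Nat.cast_nonneg (α := ℝ) k) hτ.le]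
        have hnext : ((k + 1 : ℕ) + 1 : ℝ) * τ = (k + 1) * τ + τ := by push_cast; ring
        rw [hnext]
        set w := min ((k + 1) * τ + τ) ρ - τ with hw
        have hw' : min ((k + 1) * τ + τ) ρ = w + τ := by rw [hw]; ring
        have hw0 : 0 < w := by
          have : τ < min ((k + 1) * τ + τ) ρ := lt_min (by linarith) (by linarith)
          linarith
        have hw1 : w ≤ (k + 1) * τ := by linarith [min_le_left ((k + 1) * τ + τ) ρ]
        have hw2 : w + τ ≤ ρ := by linarith [min_le_right ((k + 1) * τ + τ) ρ]
        have hseg' := hseg _ (by linarith) hk.le ih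
        rw [hw']
        obtain ⟨r, hr, hyr⟩ := (W (a - w)).exists_ge_of_slope hτ.le (t := a - w) (h₀ := w)
          (f := fun v => M * X (v - (a - ρ + τ))) le_rfl
          (continuous_const.mul (P.X_shift_cont _)) hw0 (by
            intro e he
            have h0 : a - w + e = a - (w - e) := by ring
            rw [h0, hseg' w hw0.le hw1, hseg' (w - e) (by linarith [he.2]) (by linarith [he.1])]
            rw [intervalIntegral.integral_const_mul]
            have h2 := P.X_step (ρ - w) (ρ - (w - e)) (by linarith) (by linarith [he.1])
              (by linarith [he.2])
            have h3 := intervalIntegral.integral_comp_sub_right (a := a - w) (b := a - (w - e))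
              (fun s => X (s - τ)) (a - ρ)
            rw [show a - w - (a - ρ) = ρ - w by ring,
              show a - (w - e) - (a - ρ) = ρ - (w - e) by ring] at h3
            simp only [sub_sub _ (a - ρ) τ] at h3
            rw [h3, h2, abs_sub_comm]
            refine le_trans (le_of_eq ?_) (le_abs_self _)
            ring)
        rw [show a - w - (a - ρ + τ) = ρ - (w + τ) by ring] at hyr
        have hra : r ≤ a := by linarith [hr.2]
        have h1 := le_of_mul_le_mul_left (hyr.trans (hbefore r hra)) hM
        have h2 := P.X_le_imp (by linarith) (by linarith) h1
        have h3 : r = a - (w + τ) := by linarith [hr.1]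
        rw [← h3]
        refine le_antisymm ?_ hyr
        have := hbefore r hra
        rwa [h3, sub_sub_cancel, ← h3] at this
  have hpeak : y (a - ρ) = M * X (ρ - ρ) := by
    obtain ⟨k, hk⟩ := exists_nat_gt (ρ / τ)
    rw [div_lt_iff₀ hτ] at hk
    have h1 := hchain k
    rwa [min_eq_right (by nlinarith)] at h1
  have hza' : z = a := by
    have hall := hseg ρ hρ.le le_rfl hpeak
    rw [sub_self, P.X_of_nonpos 0 le_rfl, mul_one] at hpeak
    have h1 : a - ρ < z := by
      by_contra h
      push Not at h
      have : c ≤ a - ρ := csInf_le hAb ⟨h, hpeak⟩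
      linarith
    by_contra hne
    have hlt : z < a := lt_of_le_of_ne hza hne
    have h2 := hall (a - z) (by linarith) (by linarith)
    rw [sub_sub_cancel, hz] at h2
    have h3 : 0 < X (ρ - (a - z)) := P.X_pos (by linarith)
    have := mul_pos hM h3
    linarith
  rw [hza', hpeak, sub_self, P.X_of_nonpos 0 le_rfl, mul_one]

end Zeros


/-- The modulus of an oscillating solution of the delay equation is a window system. -/
theorem IsDelaySolution.windowSystem {p τd x : ℝ → ℝ} {t₀ τ Λ T : ℝ} (hx : IsDelaySolution p τd t₀ x)
    (hpm : Measurable p) (hτdm : Measurable τd) (hτdle : ∀ t, τd t ≤ t)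
    (hp1 : ∀ᵐ t : ℝ ∂volume, |p t| = 1) (hτm : ∀ t ≥ t₀, t - τd t ≤ τ)
    (hosc : ∀ a b : ℝ, T ≤ a → a < b → (∀ t ∈ Ioo a b, x t ≠ 0) → b - a ≤ Λ) :
    WindowSystem τ Λ (max t₀ T) fun t => |x t| := by
  obtain ⟨hxc, hxi⟩ := hx
  have hfi : ∀ t ≥ t₀, IntervalIntegrable (fun s => p s * x (τd s)) volume t₀ t := by
    intro t ht
    rw [intervalIntegrable_iff_integrableOn_Ioc_of_le ht]
    obtain ⟨C, hC⟩ := isCompact_Icc.exists_bound_of_continuousOn (s := Icc (t₀ - τ) t) hxc.continuousOn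
    refine Measure.integrableOn_of_bounded (M := C) (by simp)
      (hpm.mul (hxc.measurable.comp hτdm)).aestronglyMeasurable ?_
    rw [ae_restrict_iff' measurableSet_Ioc]
    filter_upwards [hp1] with s hs hst
    rw [norm_mul, Real.norm_eq_abs, hs, one_mul]
    exact hC _ ⟨by linarith [hτm s hst.1.le, hst.1], (hτdle s).trans hst.2⟩
  refine ⟨hxc.abs, fun t => abs_nonneg _, ?_, ?_⟩
  · intro s t hs hst B hB hle
    have hs₀ : t₀ ≤ s := (le_max_left _ _).trans hs
    have h1 : x t - x s = ∫ v in s..t, p v * x (τd v) := by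
      rw [hxi t (hs₀.trans hst), hxi s hs₀,
        ← intervalIntegral.integral_interval_sub_left (hfi t (hs₀.trans hst)) (hfi s hs₀)]
      ring
    refine (abs_abs_sub_abs_le_abs_sub _ _).trans ?_
    rw [h1, ← Real.norm_eq_abs]
    refine intervalIntegral.norm_integral_le_of_norm_le hst ?_ (hB.intervalIntegrable _ _)
    filter_upwards [hp1] with v hv hvs
    rw [norm_mul, Real.norm_eq_abs, hv, one_mul]
    exact hle v ⟨hvs.1.le, hvs.2⟩ _
      ⟨by linarith [hτm v (hs₀.trans hvs.1.le)], hτdle v⟩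
  · intro a b ha hab hne
    exact hosc a b ((le_max_right _ _).trans ha) hab fun t ht h0 => hne t ht (by simp [h0])

section Asymptotics

variable {τ ρ L Λ T M : ℝ} {X ψ y : ℝ → ℝ}

theorem WindowSystem.lipschitz (W : WindowSystem τ Λ T y) {S s t : ℝ} (hs : T ≤ s) (hst : s ≤ t)
    (hS : ∀ r, T - τ ≤ r → y r ≤ S) : |y t - y s| ≤ S * (t - s) := by
  have := W.slope s t hs hst (fun _ => S) continuous_const
    fun v hv r hr => hS r (by linarith [hv.1, hr.1])
  rw [intervalIntegral.integral_const, smul_eq_mul] at this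
  linarith

theorem WindowSystem.eventually_bounded (W : WindowSystem τ (ρ + L) T y) (P : Profile τ ρ L X ψ) :
    ∃ S > 0, ∀ t ≥ T, y t ≤ S := by
  have hρ := P.ρ_pos
  have hL := P.L_pos
  have hτ := P.τ_pos
  obtain ⟨z, hz, hyz⟩ := W.exists_zero (by linarith) (t := T + ρ) (by linarith)
  obtain ⟨C, hC⟩ := isCompact_Icc.exists_bound_of_continuousOn (s := Icc (T - τ) z)
    W.cont.continuousOn
  have hC' : ∀ r ∈ Icc (T - τ) z, y r ≤ |C| + 1 := fun r hr => by
    have := (le_abs_self (y r)).trans (hC r hr)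
    linarith [le_abs_self C]
  have hS : 0 < |C| + 1 := by positivity
  refine ⟨|C| + 1, hS, fun t ht => ?_⟩
  rcases le_total t z with h | h
  · exact hC' t ⟨by linarith, h⟩
  · exact W.stays_below P (by linarith [hz.1]) hS hyz
      (fun r hr => hC' r ⟨by linarith [hr.1, hz.1], hr.2⟩) t h

/-- Bounds for the limit superior of a window system, together with its frequent attainment. -/
structure WindowSystem.IsTop (τ ρ M : ℝ) (y : ℝ → ℝ) : Prop where
  pos : 0 < M
  eventually_le : ∀ S > M, ∃ T, ∀ t ≥ T, y t ≤ S
  attained : ∃ T, ∀ z ≥ T, y z = 0 → ∃ t ∈ Icc (z - ρ - τ) z, M ≤ y t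

theorem WindowSystem.isTop (W : WindowSystem τ (ρ + L) T y) (P : Profile τ ρ L X ψ)
    (hM : M = limsup y atTop) (hpos : 0 < M) : WindowSystem.IsTop τ ρ M y := by
  obtain ⟨S₀, hS₀, hle⟩ := W.eventually_bounded P
  have hbdd : IsBoundedUnder (· ≤ ·) atTop y :=
    ⟨S₀, eventually_map.mpr (eventually_atTop.mpr ⟨T, hle⟩)⟩
  have hcobdd : IsCoboundedUnder (· ≤ ·) atTop y :=
    (isBoundedUnder_of ⟨0, W.nonneg⟩ : IsBoundedUnder (· ≥ ·) atTop y).isCoboundedUnder_flip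
  refine ⟨hpos, fun S hS => ?_, T + ρ, fun z hz hyz => ?_⟩
  · have := eventually_lt_of_limsup_lt (hM ▸ hS) hbdd
    obtain ⟨T', hT'⟩ := eventually_atTop.mp this
    exact ⟨T', fun t ht => (hT' t ht).le⟩
  · by_contra hn
    push Not at hn
    have hρ := P.ρ_pos
    have hτ := P.τ_pos
    obtain ⟨r₀, hr₀, hmax⟩ := isCompact_Icc.exists_isMaxOn
      (nonempty_Icc.mpr (by linarith : z - ρ - τ ≤ z)) W.cont.continuousOn
    obtain ⟨S, hS1, hS2⟩ := exists_between (hn r₀ hr₀)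
    have h1 := W.stays_below P (by linarith) ((W.nonneg r₀).trans_lt hS1) hyz
      fun r hr => (hmax hr).trans hS1.le
    have : limsup y atTop ≤ S := limsup_le_of_le hcobdd (eventually_atTop.mpr ⟨z, h1⟩)
    linarith

end Asymptotics

section Translates

variable {τ ρ L T M : ℝ} {X ψ y : ℝ → ℝ}

/-- Late translates of a window system converge, along an ultrafilter and locally uniformly, to
an entire window system. -/
theorem WindowSystem.exists_limit (W : WindowSystem τ (ρ + L) T y) (P : Profile τ ρ L X ψ)
    {z : ℕ → ℝ} (hz : Tendsto z atTop atTop) {𝓕 : Ultrafilter ℕ} (h𝓕 : (𝓕 : Filter ℕ) ≤ atTop) :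
    ∃ w : ℝ → ℝ, (∀ T', WindowSystem τ (ρ + L) T' w) ∧
      ∀ a b ε, 0 < ε → ∀ᶠ k in (𝓕 : Filter ℕ), ∀ s ∈ Icc a b, |y (z k + s) - w s| ≤ ε := by
  have hτ := P.τ_pos
  obtain ⟨S, hS, hle⟩ := W.eventually_bounded P
  have hlate : ∀ C, ∀ᶠ k in (𝓕 : Filter ℕ), C ≤ z k := fun C =>
    h𝓕 (hz.eventually_ge_atTop C)
  have hlim : ∀ s, ∃ l, Tendsto (fun k => y (z k + s)) 𝓕 (nhds l) := by
    intro s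
    have hmem : ∀ᶠ k in (𝓕 : Filter ℕ), y (z k + s) ∈ Icc 0 S := by
      filter_upwards [hlate (T - s)] with k hk
      exact ⟨W.nonneg _, hle _ (by linarith)⟩
    obtain ⟨l, -, hl⟩ := (isCompact_Icc (a := (0 : ℝ)) (b := S)).ultrafilter_le_nhds
      (𝓕.map fun k => y (z k + s)) (le_principal_iff.mpr hmem)
    exact ⟨l, hl⟩
  choose w hw using hlim
  have hlipk : ∀ a, ∀ᶠ k in (𝓕 : Filter ℕ), ∀ s t, a ≤ s → a ≤ t →
      |y (z k + t) - y (z k + s)| ≤ S * |t - s| := by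
    intro a
    filter_upwards [hlate (T + τ - a)] with k hk s t hs ht
    have hL := W.mono (show T ≤ T + τ by linarith)
    rcases le_total s t with h | h
    · have := hL.lipschitz (S := S) (s := z k + s) (t := z k + t) (by linarith) (by linarith)
        fun r hr => hle r (by linarith)
      rwa [add_sub_add_left_eq_sub, ← abs_of_nonneg (sub_nonneg.mpr h)] at this
    · have := hL.lipschitz (S := S) (s := z k + t) (t := z k + s) (by linarith) (by linarith)
        fun r hr => hle r (by linarith)
      rwa [add_sub_add_left_eq_sub, ← abs_of_nonneg (sub_nonneg.mpr h), abs_sub_comm,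
        abs_sub_comm s] at this
  have hlip : ∀ s t, |w t - w s| ≤ S * |t - s| := by
    intro s t
    refine le_of_tendsto ((hw t).sub (hw s)).abs ?_
    filter_upwards [hlipk (min s t)] with k hk
    exact hk s t (min_le_left _ _) (min_le_right _ _)
  have hcont : Continuous w := by
    have : LipschitzWith S.toNNReal w := by
      refine LipschitzWith.of_dist_le_mul fun s t => ?_
      rw [Real.coe_toNNReal _ hS.le, Real.dist_eq, Real.dist_eq]
      exact hlip t s
    exact this.continuous
  have hunif : ∀ a b ε, 0 < ε → ∀ᶠ k in (𝓕 : Filter ℕ), ∀ s ∈ Icc a b,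
      |y (z k + s) - w s| ≤ ε := by
    intro a b ε hε
    by_contra hn
    rw [← Ultrafilter.eventually_not] at hn
    push Not at hn
    have hch : ∃ σ : ℕ → ℝ, ∀ᶠ k in (𝓕 : Filter ℕ), σ k ∈ Icc a b ∧
        ε < |y (z k + σ k) - w (σ k)| := by
      classical
      refine ⟨fun k => if h : ∃ s ∈ Icc a b, ε < |y (z k + s) - w s| then h.choose else 0, ?_⟩
      filter_upwards [hn] with k hk
      rw [dif_pos hk]
      exact hk.choose_spec
    obtain ⟨σ, hσ⟩ := hch
    obtain ⟨q, hq, hσq⟩ := (isCompact_Icc (a := a) (b := b)).ultrafilter_le_nhds (𝓕.map σ)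
      (le_principal_iff.mpr (hσ.mono fun k hk => hk.1))
    have hσq' : Tendsto σ 𝓕 (nhds q) := hσq
    have h1 : Tendsto (fun k => S * |σ k - q| + |y (z k + q) - w q| + S * |q - σ k|) 𝓕
        (nhds (S * |q - q| + |w q - w q| + S * |q - q|)) :=
      (((hσq'.sub_const q).abs.const_mul S).add ((hw q).sub_const (w q)).abs).add
        ((hσq'.const_sub q).abs.const_mul S)
    simp only [sub_self, abs_zero, mul_zero, add_zero] at h1
    obtain ⟨k, hk1, hk2, hk3⟩ := ((h1.eventually_lt_const hε).and (hσ.and (hlipk a))).exists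
    have h2 := hk3 q (σ k) hq.1 hk2.1.1
    have h3 := hlip (σ k) q
    have h4 : |y (z k + σ k) - w (σ k)| ≤ |y (z k + σ k) - y (z k + q)| + |y (z k + q) - w q| +
        |w q - w (σ k)| :=
      calc |y (z k + σ k) - w (σ k)|
          = |(y (z k + σ k) - y (z k + q)) + (y (z k + q) - w q) + (w q - w (σ k))| := by
            congr 1; ring
        _ ≤ _ := abs_add_three _ _ _
    linarith [hk2.2]
  refine ⟨w, fun T' => ⟨hcont, fun t => ge_of_tendsto' (hw t) fun k => W.nonneg _, ?_, ?_⟩, hunif⟩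
  · intro s t _ hst B hB hBle
    have hε : ∀ ε > 0, |w t - w s| ≤ (∫ v in s..t, B v) + ε * (t - s) := by
      intro ε hε
      refine le_of_tendsto ((hw t).sub (hw s)).abs ?_
      filter_upwards [hunif (s - τ) t ε hε, hlate (T - s)] with k hk1 hk2
      have h1 := W.slope (z k + s) (z k + t) (by linarith) (by linarith)
        (fun v => B (v - z k) + ε) ((hB.comp (continuous_sub_right _)).add continuous_const) ?_
      · rw [intervalIntegral.integral_comp_sub_right (fun v => B v + ε) (z k),
          add_sub_cancel_left, add_sub_cancel_left, intervalIntegral.integral_add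
            (hB.intervalIntegrable _ _) intervalIntegrable_const,
          intervalIntegral.integral_const, smul_eq_mul] at h1
        linarith
      · intro v hv r hr
        have h2 := hk1 (r - z k) ⟨by linarith [hr.1, hv.1], by linarith [hr.2, hv.2]⟩
        rw [add_sub_cancel] at h2
        have h3 := hBle (v - z k) ⟨by linarith [hv.1], by linarith [hv.2]⟩ (r - z k)
          ⟨by linarith [hr.1], by linarith [hr.2]⟩
        linarith [le_abs_self (y r - w (r - z k))]
    refine le_of_forall_pos_le_add fun δ hδ => ?_
    have := hε (δ / (t - s + 1)) (div_pos hδ (by linarith))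
    have h5 : δ / (t - s + 1) * (t - s) ≤ δ := by
      rw [div_mul_eq_mul_div, div_le_iff₀ (by linarith)]
      nlinarith
    linarith
  · intro a b _ hab hne
    by_contra hn
    push Not at hn
    set e := (b - a - (ρ + L)) / 3 with he
    have he0 : 0 < e := by rw [he]; linarith
    have h3e : 3 * e = b - a - (ρ + L) := by rw [he]; ring
    have hΛ : 0 < ρ + L := by linarith [P.ρ_pos, P.L_pos]
    obtain ⟨q, hq, hmin⟩ := isCompact_Icc.exists_isMinOn
      (nonempty_Icc.mpr (by linarith : a + e ≤ b - e)) hcont.continuousOn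
    have hq0 : 0 < w q :=
      lt_of_le_of_ne (ge_of_tendsto' (hw q) fun k => W.nonneg _)
        (hne q ⟨by linarith [hq.1], by linarith [hq.2]⟩).symm
    obtain ⟨k, hk1, hk2⟩ :=
      ((hunif (a + e) (b - e) (w q / 2) (by linarith)).and (hlate (T - a - e))).exists
    have := W.osc (z k + (a + e)) (z k + (b - e)) (by linarith) (by linarith) fun r hr h0 => by
      have h1 : r - z k ∈ Icc (a + e) (b - e) := ⟨by linarith [hr.1], by linarith [hr.2]⟩
      have h2 := hk1 _ h1
      rw [add_sub_cancel, h0, zero_sub, abs_neg] at h2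
      have h3 : w q ≤ w (r - z k) := hmin h1
      linarith [le_abs_self (w (r - z k))]
    linarith

/-- Late zeros are preceded, at distance `ρ`, by almost maximal values. -/
theorem WindowSystem.peak_before_zero (W : WindowSystem τ (ρ + L) T y) (P : Profile τ ρ L X ψ)
    (hM : WindowSystem.IsTop τ ρ M y) {ε : ℝ} (hε : 0 < ε) :
    ∃ T', ∀ z ≥ T', y z = 0 → M - ε ≤ y (z - ρ) := by
  by_contra hn
  push Not at hn
  have hρ := P.ρ_pos
  have hL := P.L_pos
  have hτ := P.τ_pos
  choose z hz hyz hlt using fun k : ℕ => hn k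
  have hzt : Tendsto z atTop atTop := tendsto_atTop_mono hz tendsto_natCast_atTop_atTop
  have h𝓕 : ((hyperfilter ℕ : Ultrafilter ℕ) : Filter ℕ) ≤ atTop := by
    rw [← Nat.cofinite_eq_atTop]; exact hyperfilter_le_cofinite
  obtain ⟨w, hW, hunif⟩ := W.exists_limit P hzt h𝓕
  set 𝓕 : Filter ℕ := ((hyperfilter ℕ : Ultrafilter ℕ) : Filter ℕ) with h𝓕def
  have hlate : ∀ C, ∀ᶠ k in 𝓕, C ≤ z k := fun C => h𝓕 (hzt.eventually_ge_atTop C)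
  have hcont := (hW 0).cont
  have hwM : ∀ s, w s ≤ M := by
    intro s
    refine le_of_forall_pos_le_add fun δ hδ => ?_
    obtain ⟨T', hT'⟩ := hM.eventually_le (M + δ / 2) (by linarith)
    obtain ⟨k, hk1, hk2⟩ := ((hunif s s (δ / 2) (by linarith)).and (hlate (T' - s))).exists
    have h1 := abs_le.mp (hk1 s ⟨le_rfl, le_rfl⟩)
    linarith [hT' (z k + s) (by linarith)]
  have hw0 : w 0 = 0 := by
    refine le_antisymm (le_of_forall_pos_le_add fun δ hδ => ?_) ((hW 0).nonneg 0)
    obtain ⟨k, hk1⟩ := (hunif 0 0 δ hδ).exists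
    have h1 := abs_le.mp (hk1 0 ⟨le_rfl, le_rfl⟩)
    rw [add_zero, hyz k] at h1
    linarith
  have hwρ : w (0 - ρ) ≤ M - ε / 2 := by
    obtain ⟨k, hk1⟩ := (hunif (0 - ρ) (0 - ρ) (ε / 2) (by linarith)).exists
    have h1 := abs_le.mp (hk1 (0 - ρ) ⟨le_rfl, le_rfl⟩)
    have h2 := hlt k
    rw [show z k + (0 - ρ) = z k - ρ by ring] at h1
    linarith
  have hex : ∃ t ≥ 0, w t = M := by
    set K := ρ + τ + (ρ + L) + 1 with hK
    obtain ⟨q, hq, hmax⟩ := isCompact_Icc.exists_isMaxOn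
      (nonempty_Icc.mpr (by linarith : (0 : ℝ) ≤ K)) hcont.continuousOn
    refine ⟨q, hq.1, le_antisymm (hwM q) (le_of_forall_pos_le_add fun δ hδ => ?_)⟩
    obtain ⟨T', hT'⟩ := hM.attained
    obtain ⟨k, hk1, hk2⟩ := ((hunif 0 K δ hδ).and (hlate (max T T'))).exists
    have hk3 := (le_max_left _ _).trans hk2
    have hk4 := (le_max_right _ _).trans hk2
    obtain ⟨z', hz', hyz'⟩ := W.exists_zero (by linarith) (t := z k + ρ + τ) (by linarith)
    obtain ⟨t, ht, hyt⟩ := hT' z' (by linarith [hz'.1]) hyz'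
    have h1 : t - z k ∈ Icc 0 K := ⟨by linarith [ht.1, hz'.1], by linarith [ht.2, hz'.2]⟩
    have h2 := abs_le.mp (hk1 _ h1)
    rw [add_sub_cancel] at h2
    have h3 : w (t - z k) ≤ w q := hmax h1
    linarith
  have := WindowSystem.rigid hW P hM.pos hwM hw0 hex
  linarith

end Translates

section Lobes

variable {τ ρ L Λ T M δ S N : ℝ} {X ψ y : ℝ → ℝ}

theorem Profile.ψ_zero (P : Profile τ ρ L X ψ) : ψ 0 = 0 := P.ψ_of_nonpos 0 le_rfl

theorem Profile.ψ_pos (P : Profile τ ρ L X ψ) {t : ℝ} (ht : 0 < t) : 0 < ψ t := by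
  rw [← P.ψ_zero]
  exact P.ψ_strict (self_mem_Ici) ht.le ht

theorem Profile.exists_rate_ge (P : Profile τ ρ L X ψ) :
    ∃ k > 0, ∀ s ∈ Icc 0 L, k ≤ max (X (ρ + s - τ)) (ψ s) := by
  obtain ⟨q, hq, hmin⟩ := isCompact_Icc.exists_isMinOn (nonempty_Icc.mpr P.L_pos.le)
    P.rate_cont.continuousOn
  refine ⟨_, ?_, hmin⟩
  rcases hq.1.eq_or_lt with h | h
  · exact lt_max_of_lt_left (P.X_pos (by linarith [P.τ_pos]))
  · exact lt_max_of_lt_right (P.ψ_pos h)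

/-- A delay `g` between the last decay and the next growth costs a definite fraction of the
height. -/
theorem Profile.exists_gap_loss (P : Profile τ ρ L X ψ) :
    ∃ g₀ > 0, ∃ κ > 0, ∀ g ∈ Icc 0 g₀,
      (∫ s in 0..L, max (X (ρ + g + s - τ)) (max (ψ s) (ψ g))) ≤ 1 - κ * g := by
  have hτ := P.τ_pos
  have hρ := P.ρ_pos
  obtain ⟨k, hk, hrate⟩ := P.exists_rate_ge
  set s₀ := max 0 (τ - ρ) with hs₀
  have hs₀L : s₀ < L := P.start_lt
  have hs₀τ : s₀ < τ := max_lt hτ (by linarith)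
  have hs₀0 : 0 ≤ s₀ := le_max_left _ _
  have hs₀ρ : τ - ρ ≤ s₀ := le_max_right _ _
  have hf : Continuous fun s => X (ρ + s - τ) - ψ s :=
    (P.X_cont.comp ((continuous_const.add continuous_id).sub continuous_const)).sub P.ψ_cont
  set q := (X (ρ + s₀ - τ) - ψ s₀) / 2 with hq
  have hq0 : 0 < q := by have := P.ψ_start_lt; rw [hq]; linarith
  have hev : ∀ᶠ s in nhds s₀, q < X (ρ + s - τ) - ψ s :=
    (hf.tendsto s₀).eventually_const_lt (by linarith)
  obtain ⟨d, hd, hball⟩ := Metric.eventually_nhds_iff.mp hev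
  obtain ⟨t₂, ht₂, ht₂'⟩ := exists_between (lt_min (lt_add_of_pos_right s₀ hd) (lt_min hs₀L hs₀τ))
  have ht₂d : t₂ < s₀ + d := ht₂'.trans_le (min_le_left _ _)
  have ht₂L : t₂ < L := ht₂'.trans_le ((min_le_right _ _).trans (min_le_left _ _))
  have ht₂τ : t₂ < τ := ht₂'.trans_le ((min_le_right _ _).trans (min_le_right _ _))
  have hgap : ∀ s ∈ Icc s₀ t₂, q ≤ X (ρ + s - τ) - ψ s := fun s hs =>
    (hball (by rw [Real.dist_eq, abs_of_nonneg (by linarith [hs.1])]; linarith [hs.2])).le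
  set κ := X (ρ - τ) with hκ
  have hκ0 : 0 < κ := P.X_pos (by linarith)
  have hev₂ : ∀ᶠ g in nhds (0 : ℝ), ψ g < min k (q / 2) :=
    (P.ψ_cont.tendsto 0).eventually_lt_const (by rw [P.ψ_zero]; exact lt_min hk (by linarith))
  obtain ⟨e, he, hball₂⟩ := Metric.eventually_nhds_iff.mp hev₂
  set g₀ := min (e / 2) (min (τ - t₂) (q / (2 * κ))) with hg₀
  have hg₀0 : 0 < g₀ := lt_min (by linarith) (lt_min (by linarith) (by positivity))
  refine ⟨g₀, hg₀0, κ * (t₂ - s₀), mul_pos hκ0 (by linarith), fun g hg => ?_⟩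
  have hge : g ≤ e / 2 := hg.2.trans (min_le_left _ _)
  have hgτ : g ≤ τ - t₂ := hg.2.trans ((min_le_right _ _).trans (min_le_left _ _))
  have hgq : κ * g ≤ q / 2 := by
    have h : g ≤ q / (2 * κ) := hg.2.trans ((min_le_right _ _).trans (min_le_right _ _))
    rw [le_div_iff₀ (by positivity)] at h
    linarith
  have hψg : ψ g < min k (q / 2) := hball₂ (by
    rw [Real.dist_eq, sub_zero, abs_of_nonneg hg.1]; linarith)
  have hψk : ψ g ≤ k := (hψg.trans_le (min_le_left _ _)).le
  have hψq : ψ g ≤ q / 2 := (hψg.trans_le (min_le_right _ _)).le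
  have hBc : Continuous fun s => max (X (ρ + g + s - τ)) (max (ψ s) (ψ g)) :=
    (P.X_cont.comp ((continuous_const.add continuous_id).sub continuous_const)).max
      (P.ψ_cont.max continuous_const)
  have hdc := P.rate_cont.sub hBc
  have h1 := P.ψ_step 0 L le_rfl P.L_pos.le
  rw [P.ψ_L, P.ψ_zero, zero_add] at h1
  have hpt : ∀ s ∈ Icc 0 L, max (X (ρ + g + s - τ)) (max (ψ s) (ψ g)) ≤
      max (X (ρ + s - τ)) (ψ s) := fun s hs =>
    max_le (le_max_of_le_left (P.X_anti (by linarith [hg.1])))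
      (max_le (le_max_right _ _) (hψk.trans (hrate s hs)))
  have hpt₂ : ∀ s ∈ Icc s₀ t₂, κ * g ≤
      max (X (ρ + s - τ)) (ψ s) - max (X (ρ + g + s - τ)) (max (ψ s) (ψ g)) := by
    intro s hs
    have h2 := hgap s hs
    have h3 := P.ψ_nonneg s
    rw [le_sub_iff_add_le, ← le_sub_iff_add_le']
    have h4 := le_max_left (X (ρ + s - τ)) (ψ s)
    refine max_le ?_ (max_le (by linarith) (by linarith))
    have h5 := P.X_step (ρ + s - τ) (ρ + g + s - τ) (by linarith [hs.1]) (by linarith [hg.1])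
      (by linarith [hs.2])
    have h6 : ∫ v in (ρ + s - τ)..(ρ + g + s - τ), κ ≤
        ∫ v in (ρ + s - τ)..(ρ + g + s - τ), X (v - τ) :=
      intervalIntegral.integral_mono_on (by linarith [hg.1]) intervalIntegrable_const
        ((P.X_shift_cont τ).intervalIntegrable _ _)
        fun v hv => P.X_anti (by linarith [hv.2, hs.2])
    rw [intervalIntegral.integral_const, smul_eq_mul] at h6
    linarith
  have h7 : κ * g * (t₂ - s₀) ≤ ∫ s in 0..L,
      (max (X (ρ + s - τ)) (ψ s) - max (X (ρ + g + s - τ)) (max (ψ s) (ψ g))) := by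
    calc κ * g * (t₂ - s₀) = ∫ s in s₀..t₂, κ * g := by
          rw [intervalIntegral.integral_const, smul_eq_mul, mul_comm]
      _ ≤ ∫ s in s₀..t₂,
          (max (X (ρ + s - τ)) (ψ s) - max (X (ρ + g + s - τ)) (max (ψ s) (ψ g))) :=
          intervalIntegral.integral_mono_on ht₂.le intervalIntegrable_const
            (hdc.intervalIntegrable _ _) hpt₂
      _ ≤ _ := intervalIntegral.integral_mono_interval hs₀0 ht₂.le ht₂L.le
          ((ae_restrict_iff' measurableSet_Ioc).mpr (ae_of_all _ fun s hs =>
            sub_nonneg.mpr (hpt s ⟨hs.1.le, hs.2⟩)))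
          (hdc.intervalIntegrable _ _)
  rw [intervalIntegral.integral_sub (P.rate_cont.intervalIntegrable _ _)
    (hBc.intervalIntegrable _ _), ← h1] at h7
  linarith

/-- Regime in which `y` is confined to `[0, S]` and all zeros are preceded by values `≥ N`, with
`N / S` close to `1`. -/
structure LateRegime (τ ρ L T δ S N : ℝ) (X ψ y : ℝ → ℝ) : Prop where
  sys : WindowSystem τ (ρ + L) (T - ρ) y
  le : ∀ t ≥ T - ρ - τ, y t ≤ S
  peak : ∀ z ≥ T, y z = 0 → N ≤ y (z - ρ)
  S_pos : 0 < S
  N_pos : 0 < N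
  δ_pos : 0 < δ
  δ_le_ρ : 3 * δ ≤ ρ
  δ_le_L : 2 * δ ≤ L
  δ_le_sub : 2 * δ ≤ ρ + L - τ
  X_lt : S * X δ < N
  ψ_lt : S * ψ (L - δ) < N

/-- A nodal interval `(a, b)` of length more than `ρ` together with a maximizer `c`. -/
structure IsLobe (ρ : ℝ) (y : ℝ → ℝ) (a b c : ℝ) : Prop where
  left : y a = 0
  right : y b = 0
  free : ∀ r ∈ Ioo a b, y r ≠ 0
  mem : c ∈ Icc a b
  le_top : ∀ r ∈ Icc a b, y r ≤ y c
  long : ρ < b - a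

namespace LateRegime

theorem before (R : LateRegime τ ρ L T δ S N X ψ y) (P : Profile τ ρ L X ψ) {a : ℝ} (ha : T ≤ a)
    (hya : y a = 0) : ∀ r ∈ Icc (a - ρ - τ) a, y r ≤ S * X (ρ - (a - r)) :=
  R.sys.le_before_zero P (by linarith) R.S_pos hya fun r hr => R.le r (by linarith [hr.1])

theorem after (R : LateRegime τ ρ L T δ S N X ψ y) (P : Profile τ ρ L X ψ) {a : ℝ} (ha : T ≤ a)
    (hya : y a = 0) : ∀ t, 0 ≤ t → y (a + t) ≤ S * ψ t :=
  R.sys.growth P (by linarith [P.ρ_pos]) R.S_pos hya fun r hr =>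
    R.before P ha hya r ⟨by linarith [hr.1, P.ρ_pos], hr.2⟩

/-- Two zeros at distance at most `ρ` are close together. -/
theorem close (R : LateRegime τ ρ L T δ S N X ψ y) (P : Profile τ ρ L X ψ) {d b : ℝ} (hd : T ≤ d)
    (hdb : d ≤ b) (hbd : b ≤ d + ρ) (hyd : y d = 0) (hyb : y b = 0) : b - d < δ := by
  have h1 := R.before P hd hyd (b - ρ) ⟨by linarith [P.τ_pos], by linarith⟩
  have h2 := R.peak b (hd.trans hdb) hyb
  by_contra hn
  push Not at hn
  have h3 : X (ρ - (d - (b - ρ))) ≤ X δ := P.X_anti (by linarith)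
  have := mul_le_mul_of_nonneg_left h3 R.S_pos.le
  linarith [R.X_lt]

theorem next (R : LateRegime τ ρ L T δ S N X ψ y) (P : Profile τ ρ L X ψ) {b : ℝ} (hb : T ≤ b)
    (hyb : y b = 0) : ∃ a' b' c', b ≤ a' ∧ a' < b + δ ∧ IsLobe ρ y a' b' c' := by
  have hρ := P.ρ_pos
  have hδ := R.δ_pos
  have hδρ := R.δ_le_ρ
  have hcl : IsClosed (y ⁻¹' {0}) := isClosed_singleton.preimage R.sys.cont
  have hAne : (Icc b (b + ρ) ∩ y ⁻¹' {0}).Nonempty := ⟨b, ⟨le_rfl, by linarith⟩, hyb⟩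
  have hA := (isCompact_Icc.inter_right hcl).sSup_mem hAne
  set a' := sSup (Icc b (b + ρ) ∩ y ⁻¹' {0}) with ha'
  have hAb : BddAbove (Icc b (b + ρ) ∩ y ⁻¹' {0}) := ⟨b + ρ, fun r hr => hr.1.2⟩
  have hya' : y a' = 0 := hA.2
  have ha'δ := R.close P hb hA.1.1 hA.1.2 hyb hya'
  obtain ⟨z, hz, hyz⟩ := R.sys.exists_zero (by linarith [P.L_pos]) (t := b + ρ) (by linarith)
  have hBb : BddBelow (Ici (b + ρ) ∩ y ⁻¹' {0}) := ⟨b + ρ, fun r hr => hr.1⟩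
  have hB := (isClosed_Ici.inter hcl).csInf_mem ⟨z, hz.1, hyz⟩ hBb
  set b' := sInf (Ici (b + ρ) ∩ y ⁻¹' {0}) with hb'
  have hyb' : y b' = 0 := hB.2
  have hbb' : b + ρ ≤ b' := hB.1
  have hlong : ρ < b' - a' := by
    by_contra hn
    push Not at hn
    have := R.close P (hb.trans hA.1.1) (by linarith) (by linarith) hya' hyb'
    linarith
  obtain ⟨c', hc', hmax⟩ := isCompact_Icc.exists_isMaxOn
    (nonempty_Icc.mpr (by linarith : a' ≤ b')) R.sys.cont.continuousOn
  refine ⟨a', b', c', hA.1.1, by linarith, hya', hyb', fun r hr h0 => ?_, hc', hmax, hlong⟩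
  rcases le_total r (b + ρ) with h | h
  · have : r ≤ a' := le_csSup hAb ⟨⟨hA.1.1.trans hr.1.le, h⟩, h0⟩
    linarith [hr.1]
  · have : b' ≤ r := csInf_le hBb ⟨h, h0⟩
    linarith [hr.2]

variable {a b c : ℝ}

theorem top_ge (R : LateRegime τ ρ L T δ S N X ψ y) (P : Profile τ ρ L X ψ) (ha : T ≤ a)
    (I : IsLobe ρ y a b c) : N ≤ y c :=
  (R.peak b (by linarith [I.long, P.ρ_pos]) I.right).trans
    (I.le_top _ ⟨by linarith [I.long], by linarith [P.ρ_pos]⟩)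

theorem rise_gt (R : LateRegime τ ρ L T δ S N X ψ y) (P : Profile τ ρ L X ψ) (ha : T ≤ a)
    (I : IsLobe ρ y a b c) : L - δ < c - a := by
  by_contra hn
  push Not at hn
  have h1 := R.after P ha I.left (c - a) (by linarith [I.mem.1])
  rw [add_sub_cancel] at h1
  have := mul_le_mul_of_nonneg_left (P.ψ_mono hn) R.S_pos.le
  linarith [R.ψ_lt, R.top_ge P ha I]

theorem le_top_before (R : LateRegime τ ρ L T δ S N X ψ y) (P : Profile τ ρ L X ψ) (ha : T ≤ a)
    (I : IsLobe ρ y a b c) : ∀ r ∈ Icc (c - τ) b, y r ≤ y c := by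
  intro r hr
  rcases le_total a r with h | h
  · exact I.le_top r ⟨h, hr.2⟩
  · have h1 := R.rise_gt P ha I
    have h2 := R.before P ha I.left r ⟨by linarith [hr.1, R.δ_le_L, R.δ_pos, P.ρ_pos], h⟩
    have h3 : X (ρ - (a - r)) ≤ X δ := P.X_anti (by linarith [hr.1, R.δ_le_sub])
    have := mul_le_mul_of_nonneg_left h3 R.S_pos.le
    linarith [R.X_lt, R.top_ge P ha I]

/-- Up to a zero `d` shortly after a lobe, the lobe height dominates `y`. -/
theorem le_top_upto (R : LateRegime τ ρ L T δ S N X ψ y) (P : Profile τ ρ L X ψ) (ha : T ≤ a)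
    (I : IsLobe ρ y a b c) {d : ℝ} (hd : d < b + δ) : ∀ r ∈ Icc (c - τ) d, y r ≤ y c := by
  intro r hr
  rcases le_total r b with h | h
  · exact R.le_top_before P ha I r ⟨hr.1, h⟩
  · have h1 := R.after P (by linarith [I.long, P.ρ_pos]) I.right (r - b) (by linarith)
    rw [add_sub_cancel] at h1
    have h2 : ψ (r - b) ≤ ψ (L - δ) := P.ψ_mono (by linarith [hr.2, R.δ_le_L])
    have := mul_le_mul_of_nonneg_left h2 R.S_pos.le
    linarith [R.ψ_lt, R.top_ge P ha I]

theorem decay_upto (R : LateRegime τ ρ L T δ S N X ψ y) (P : Profile τ ρ L X ψ) (ha : T ≤ a)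
    (I : IsLobe ρ y a b c) {d : ℝ} (hbd : b ≤ d) (hd : d < b + δ) (hyd : y d = 0) :
    ρ ≤ d - c ∧ ∀ r ∈ Icc (d - τ) d, y r ≤ y c * X (ρ - (d - r)) := by
  have hm : 0 < y c := R.N_pos.trans_le (R.top_ge P ha I)
  have hle := R.le_top_upto P ha I hd
  obtain ⟨h1, h2⟩ := R.sys.decay P (c := c) (d := d) (u := ρ) (by linarith [I.mem.1, P.ρ_pos])
    (I.mem.2.trans hbd) hm hle P.ρ_pos.le le_rfl
    (by rw [hyd, P.X_of_ge ρ le_rfl, mul_zero]) (Or.inl rfl)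
  refine ⟨h1, fun r hr => ?_⟩
  rcases le_total c r with h | h
  · have := h2 r ⟨h, hr.2⟩
    rwa [show r - d + ρ = ρ - (d - r) by ring] at this
  · rw [P.X_of_nonpos _ (by linarith), mul_one]
    exact hle r ⟨by linarith [hr.1, I.mem.2], hr.2⟩

theorem rise_le (R : LateRegime τ ρ L T δ S N X ψ y) (P : Profile τ ρ L X ψ) (ha : T ≤ a)
    (I : IsLobe ρ y a b c) : c - a ≤ L := by
  have h1 := (R.decay_upto P ha I le_rfl (by linarith [R.δ_pos]) I.right).1
  have h2 := R.sys.osc a b (by linarith [P.ρ_pos]) (by linarith [I.long, P.ρ_pos]) I.free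
  linarith

theorem growth_from (R : LateRegime τ ρ L T δ S N X ψ y) (P : Profile τ ρ L X ψ) (ha : T ≤ a)
    (I : IsLobe ρ y a b c) {d : ℝ} (hbd : b ≤ d) (hd : d < b + δ) (hyd : y d = 0) :
    ∀ t, 0 ≤ t → y (d + t) ≤ y c * ψ t :=
  R.sys.growth P (by linarith [I.long, P.ρ_pos]) (R.N_pos.trans_le (R.top_ge P ha I)) hyd
    (R.decay_upto P ha I hbd hd hyd).2

variable {a' b' c' : ℝ}

theorem top_loss_rise (R : LateRegime τ ρ L T δ S N X ψ y) (P : Profile τ ρ L X ψ) (ha : T ≤ a)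
    (I : IsLobe ρ y a b c) (I' : IsLobe ρ y a' b' c') (hba : b ≤ a') (hab : a' < b + δ) {k : ℝ}
    (hk : 0 < k) (hrate : ∀ s ∈ Icc 0 L, k ≤ max (X (ρ + s - τ)) (ψ s)) :
    N * k * (L - (c' - a')) ≤ y c - y c' := by
  have ha' : T ≤ a' := by linarith [I.long, P.ρ_pos]
  have h1 := R.growth_from P ha I hba hab I'.left (c' - a') (by linarith [I'.mem.1])
  rw [add_sub_cancel] at h1
  have hL := R.rise_le P ha' I'
  have h2 := P.ψ_step (c' - a') L (by linarith [I'.mem.1]) hL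
  rw [P.ψ_L] at h2
  have h3 : ∫ s in (c' - a')..L, k ≤ ∫ s in (c' - a')..L, max (X (ρ + s - τ)) (ψ s) :=
    intervalIntegral.integral_mono_on hL intervalIntegrable_const
      (P.rate_cont.intervalIntegrable _ _)
      fun s hs => hrate s ⟨by linarith [hs.1, I'.mem.1], hs.2⟩
  rw [intervalIntegral.integral_const, smul_eq_mul] at h3
  have hN := R.top_ge P ha I
  have h4 : N * (k * (L - (c' - a'))) ≤ y c * (k * (L - (c' - a'))) :=
    mul_le_mul_of_nonneg_right hN (mul_nonneg hk.le (by linarith))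
  have h5 : y c * (k * (L - (c' - a'))) ≤ y c * (1 - ψ (c' - a')) :=
    mul_le_mul_of_nonneg_left (by linarith) (R.N_pos.le.trans hN)
  linarith

theorem top_loss_gap (R : LateRegime τ ρ L T δ S N X ψ y) (P : Profile τ ρ L X ψ) (ha : T ≤ a)
    (I : IsLobe ρ y a b c) (I' : IsLobe ρ y a' b' c') (hba : b ≤ a') (hab : a' < b + δ) {κ : ℝ}
    (hκ : 0 < κ) (hgap : (∫ s in 0..L, max (X (ρ + (a' - b) + s - τ))
      (max (ψ s) (ψ (a' - b)))) ≤ 1 - κ * (a' - b)) :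
    N * κ * (a' - b) ≤ y c - y c' := by
  have ha' : T ≤ a' := by linarith [I.long, P.ρ_pos]
  have hN := R.top_ge P ha I
  have hm : 0 < y c := R.N_pos.trans_le hN
  have hL := R.rise_le P ha' I'
  have hBc : Continuous fun s => max (X (ρ + (a' - b) + s - τ)) (max (ψ s) (ψ (a' - b))) :=
    (P.X_cont.comp ((continuous_const.add continuous_id).sub continuous_const)).max
      (P.ψ_cont.max continuous_const)
  have h1 := R.sys.slope a' c' (by linarith [P.ρ_pos]) I'.mem.1
    (fun v => y c * max (X (ρ + (a' - b) + (v - a') - τ)) (max (ψ (v - a')) (ψ (a' - b))))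
    (continuous_const.mul (hBc.comp (continuous_sub_right a'))) ?_
  · rw [intervalIntegral.integral_comp_sub_right (fun s => y c *
      max (X (ρ + (a' - b) + s - τ)) (max (ψ s) (ψ (a' - b)))) a',
      intervalIntegral.integral_const_mul, sub_self, I'.left, sub_zero] at h1
    have h2 : (∫ s in 0..(c' - a'), max (X (ρ + (a' - b) + s - τ)) (max (ψ s) (ψ (a' - b)))) ≤
        ∫ s in 0..L, max (X (ρ + (a' - b) + s - τ)) (max (ψ s) (ψ (a' - b))) :=
      intervalIntegral.integral_mono_interval le_rfl (by linarith [I'.mem.1]) hL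
        (ae_of_all _ fun s => le_max_of_le_left (P.X_nonneg _)) (hBc.intervalIntegrable _ _)
    have h3 := mul_le_mul_of_nonneg_left (h2.trans hgap) hm.le
    have h4 : N * (κ * (a' - b)) ≤ y c * (κ * (a' - b)) :=
      mul_le_mul_of_nonneg_right hN (mul_nonneg hκ.le (by linarith))
    linarith [le_abs_self (y c')]
  · intro v hv r hr
    rcases le_total a' r with h | h
    · have h2 := R.growth_from P ha I hba hab I'.left (r - a') (by linarith)
      rw [add_sub_cancel] at h2
      refine h2.trans (mul_le_mul_of_nonneg_left ?_ hm.le)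
      exact le_max_of_le_right (le_max_of_le_left (P.ψ_mono (by linarith [hr.2])))
    rcases le_total b r with h' | h'
    · have h2 := R.growth_from P ha I le_rfl (by linarith [R.δ_pos]) I.right (r - b) (by linarith)
      rw [add_sub_cancel] at h2
      refine h2.trans (mul_le_mul_of_nonneg_left ?_ hm.le)
      exact le_max_of_le_right (le_max_of_le_right (P.ψ_mono (by linarith)))
    · have h2 := (R.decay_upto P ha I le_rfl (by linarith [R.δ_pos]) I.right).2 r
        ⟨by linarith [hr.1, hv.1], h'⟩
      refine h2.trans (mul_le_mul_of_nonneg_left ?_ hm.le)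
      exact le_max_of_le_left (P.X_anti (by linarith [hr.1]))

end LateRegime

end Lobes

section LobeSequences

variable {τ ρ L T M C : ℝ} {X ψ y : ℝ → ℝ}

/-- Consecutive lobes `[a n, b n]` with maximizers `c n`; the deviations of their shape from the
extremal profile are controlled by the losses of height. -/
structure LobeSequence (τ ρ L M C : ℝ) (X ψ y : ℝ → ℝ) (a b c : ℕ → ℝ) : Prop where
  left : ∀ n, y (a n) = 0
  right : ∀ n, y (b n) = 0
  a_le_c : ∀ n, a n ≤ c n
  fall_ge : ∀ n, ρ ≤ b n - c n
  rise_le : ∀ n, c n - a n ≤ L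
  len_le : ∀ n, b n - a n ≤ ρ + L
  b_le_a : ∀ n, b n ≤ a (n + 1)
  top_pos : ∀ n, 0 < y (c n)
  le_top : ∀ n, ∀ r ∈ Icc (c n - τ) (b n), y r ≤ y (c n)
  before : ∀ n, ∀ r ∈ Icc (a (n + 1) - τ) (a (n + 1)),
    y r ≤ y (c n) * X (ρ - (a (n + 1) - r))
  growth : ∀ n, ∀ t, 0 ≤ t → y (a (n + 1) + t) ≤ y (c n) * ψ t
  top_le : ∀ n, y (c (n + 1)) ≤ y (c n)
  rise_ge : ∀ n, L - (c (n + 1) - a (n + 1)) ≤ C * (y (c n) - y (c (n + 1)))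
  gap_le : ∀ n, a (n + 1) - b n ≤ C * (y (c n) - y (c (n + 1)))
  tendsto_top : Tendsto (fun n => y (c n)) atTop (nhds M)

theorem tendsto_atTop_of_add_le_succ {a : ℕ → ℝ} (hρ : 0 < ρ) (h : ∀ n, a n + ρ ≤ a (n + 1)) :
    Tendsto a atTop atTop := by
  have h' : ∀ n : ℕ, a 0 + n * ρ ≤ a n := by
    intro n
    induction n with
    | zero => simp
    | succ n ih =>
      push_cast
      linarith [h n]
  exact tendsto_atTop_mono h'
    (tendsto_atTop_add_const_left _ _ (tendsto_natCast_atTop_atTop.atTop_mul_const hρ))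

theorem Profile.exists_ratio (P : Profile τ ρ L X ψ) {δ : ℝ} (hδ : 0 < δ) (hδL : δ ≤ L) :
    ∃ ε ∈ Ioo (0 : ℝ) 1, (1 + ε) * X δ < 1 - ε ∧ (1 + ε) * ψ (L - δ) < 1 - ε := by
  have h1 : X δ < 1 := P.X_lt_one hδ
  have h2 : ψ (L - δ) < 1 := by
    rw [← P.ψ_L]
    exact P.ψ_strict (by simpa using hδL) P.L_pos.le (by linarith)
  set q := max (X δ) (ψ (L - δ)) with hq
  have hq1 : q < 1 := max_lt h1 h2
  have hq0 : 0 ≤ q := le_max_of_le_left (P.X_nonneg _)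
  have hmul : ∀ v ≤ q, (1 + (1 - q) / 3) * v < 1 - (1 - q) / 3 := fun v hv => by nlinarith
  exact ⟨(1 - q) / 3, ⟨by linarith, by linarith⟩, hmul _ (le_max_left _ _),
    hmul _ (le_max_right _ _)⟩

theorem WindowSystem.exists_lobeSequence (W : WindowSystem τ (ρ + L) T y) (P : Profile τ ρ L X ψ)
    (hM : WindowSystem.IsTop τ ρ M y) :
    ∃ C ≥ 0, ∃ a b c : ℕ → ℝ, T ≤ a 0 ∧ LobeSequence τ ρ L M C X ψ y a b c := by
  have hρ := P.ρ_pos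
  have hL := P.L_pos
  have hτ := P.τ_pos
  have hτL := P.τ_lt
  have hM0 := hM.pos
  obtain ⟨k, hk, hrate⟩ := P.exists_rate_ge
  obtain ⟨g₀, hg₀, κ, hκ, hgap⟩ := P.exists_gap_loss
  obtain ⟨δ, hδ, hδ'⟩ := exists_between (show (0 : ℝ) < min (min (ρ / 3) (L / 2))
    (min ((ρ + L - τ) / 2) g₀) from
      lt_min (lt_min (by linarith) (by linarith)) (lt_min (by linarith) hg₀))
  rw [lt_min_iff, lt_min_iff, lt_min_iff] at hδ'
  obtain ⟨⟨hδρ, hδL⟩, hδs, hδg⟩ := hδ'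
  obtain ⟨ε, hε, hεX, hεψ⟩ := P.exists_ratio hδ (by linarith)
  obtain ⟨T₁, hT₁⟩ := hM.eventually_le (M * (1 + ε)) (by nlinarith [hε.1])
  obtain ⟨T₂, hT₂⟩ := W.peak_before_zero P hM (mul_pos hM0 hε.1)
  set T' := max T (max T₁ T₂) + ρ + τ with hT'
  have hTT' : T + ρ + τ ≤ T' := by linarith [le_max_left T (max T₁ T₂)]
  have hT₁' : T₁ + ρ + τ ≤ T' := by
    linarith [le_max_right T (max T₁ T₂), le_max_left T₁ T₂]
  have hT₂' : T₂ + ρ + τ ≤ T' := by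
    linarith [le_max_right T (max T₁ T₂), le_max_right T₁ T₂]
  have hN0 : 0 < M * (1 - ε) := mul_pos hM0 (by linarith [hε.2])
  have R : LateRegime τ ρ L T' δ (M * (1 + ε)) (M * (1 - ε)) X ψ y :=
    { sys := W.mono (by linarith)
      le := fun t ht => hT₁ t (by linarith)
      peak := fun z hz hyz => by
        have := hT₂ z (by linarith) hyz
        linarith
      S_pos := mul_pos hM0 (by linarith [hε.1])
      N_pos := hN0
      δ_pos := hδ
      δ_le_ρ := by linarith
      δ_le_L := by linarith
      δ_le_sub := by linarith
      X_lt := by rw [mul_assoc]; exact mul_lt_mul_of_pos_left hεX hM0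
      ψ_lt := by rw [mul_assoc]; exact mul_lt_mul_of_pos_left hεψ hM0 }
  have hstep : ∀ p : {p : ℝ × ℝ × ℝ // T' ≤ p.1 ∧ IsLobe ρ y p.1 p.2.1 p.2.2},
      ∃ p' : {p : ℝ × ℝ × ℝ // T' ≤ p.1 ∧ IsLobe ρ y p.1 p.2.1 p.2.2},
        p.1.2.1 ≤ p'.1.1 ∧ p'.1.1 < p.1.2.1 + δ := by
    rintro ⟨⟨a, b, c⟩, ha, I⟩
    simp only at ha I
    have hb : T' ≤ b := by linarith [I.long]
    obtain ⟨a', b', c', h1, h2, I'⟩ := R.next P hb I.right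
    exact ⟨⟨(a', b', c'), hb.trans h1, I'⟩, h1, h2⟩
  choose f hf using hstep
  obtain ⟨z, hz, hyz⟩ := W.exists_zero (by linarith) (t := T') (by linarith)
  obtain ⟨a₀, b₀, c₀, ha₀, -, I₀⟩ := R.next P hz.1 hyz
  set p : ℕ → {p : ℝ × ℝ × ℝ // T' ≤ p.1 ∧ IsLobe ρ y p.1 p.2.1 p.2.2} :=
    fun n => f^[n] ⟨(a₀, b₀, c₀), hz.1.trans ha₀, I₀⟩ with hp
  have hps : ∀ n, p (n + 1) = f (p n) := fun n => Function.iterate_succ_apply' f n _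
  set a : ℕ → ℝ := fun n => (p n).1.1 with ha
  set b : ℕ → ℝ := fun n => (p n).1.2.1 with hb
  set c : ℕ → ℝ := fun n => (p n).1.2.2 with hc
  have hTa : ∀ n, T' ≤ a n := fun n => (p n).2.1
  have hI : ∀ n, IsLobe ρ y (a n) (b n) (c n) := fun n => (p n).2.2
  have hba : ∀ n, b n ≤ a (n + 1) := fun n => by
    have := (hf (p n)).1; rwa [← hps] at this
  have hab : ∀ n, a (n + 1) < b n + δ := fun n => by
    have := (hf (p n)).2; rwa [← hps] at this
  have hrise := fun n => R.top_loss_rise P (hTa n) (hI n) (hI (n + 1)) (hba n) (hab n) hk hrate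
  have hgapn := fun n => R.top_loss_gap P (hTa n) (hI n) (hI (n + 1)) (hba n) (hab n) hκ
    (hgap _ ⟨by linarith [hba n], by linarith [hab n]⟩)
  have htop : ∀ n, y (c (n + 1)) ≤ y (c n) := fun n => by
    have h1 := hgapn n
    have h2 : 0 ≤ M * (1 - ε) * κ * (a (n + 1) - b n) :=
      mul_nonneg (by positivity) (by linarith [hba n])
    linarith
  have hlong : ∀ n, ρ < b n - a n := fun n => (hI n).long
  have hat : Tendsto a atTop atTop :=
    tendsto_atTop_of_add_le_succ hρ fun n => by linarith [hba n, hlong n]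
  refine ⟨1 / (M * (1 - ε) * k) + 1 / (M * (1 - ε) * κ), by positivity, a, b, c,
    by linarith [hTa 0], ?_⟩
  have hC : ∀ n v K, 0 < K → M * (1 - ε) * K * v ≤ y (c n) - y (c (n + 1)) →
      v ≤ 1 / (M * (1 - ε) * K) * (y (c n) - y (c (n + 1))) := by
    intro n v K hK h
    rw [one_div_mul_eq_div, le_div_iff₀ (by positivity)]
    linarith
  have hD : ∀ n K, 0 < K → 0 ≤ 1 / (M * (1 - ε) * K) * (y (c n) - y (c (n + 1))) :=
    fun n K hK => mul_nonneg (by positivity) (by linarith [htop n])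
  exact
    { left := fun n => (hI n).left
      right := fun n => (hI n).right
      a_le_c := fun n => (hI n).mem.1
      fall_ge := fun n =>
        (R.decay_upto P (hTa n) (hI n) le_rfl (by linarith) (hI n).right).1
      rise_le := fun n => R.rise_le P (hTa n) (hI n)
      len_le := fun n => W.osc _ _ (by linarith [hTa n]) (by linarith [hlong n]) (hI n).free
      b_le_a := hba
      top_pos := fun n => hN0.trans_le (R.top_ge P (hTa n) (hI n))
      le_top := fun n => R.le_top_before P (hTa n) (hI n)
      before := fun n => (R.decay_upto P (hTa n) (hI n) (hba n) (hab n) (hI (n + 1)).left).2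
      growth := fun n => R.growth_from P (hTa n) (hI n) (hba n) (hab n) (hI (n + 1)).left
      top_le := htop
      rise_ge := fun n => by
        rw [add_mul]; linarith [hC n _ k hk (hrise n), hD n κ hκ]
      gap_le := fun n => by
        rw [add_mul]; linarith [hC n _ κ hκ (hgapn n), hD n k hk]
      tendsto_top := by
        refine Metric.tendsto_atTop.mpr fun e he => ?_
        obtain ⟨T₃, hT₃⟩ := hM.eventually_le (M + e / 2) (by linarith)
        obtain ⟨T₄, hT₄⟩ := W.peak_before_zero P hM (half_pos he)
        obtain ⟨n₀, hn₀⟩ := eventually_atTop.mp (hat.eventually_ge_atTop (max T₃ T₄))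
        refine ⟨n₀, fun n hn => ?_⟩
        have h3 := (le_max_left _ _).trans (hn₀ n hn)
        have h4 := (le_max_right _ _).trans (hn₀ n hn)
        have h5 := hT₃ (c n) (by linarith [(hI n).mem.1])
        have h6 := hT₄ (b n) (by linarith [hlong n]) (hI n).right
        have h7 := (hI n).le_top (b n - ρ) ⟨by linarith [hlong n], by linarith⟩
        rw [Real.dist_eq, abs_lt]
        constructor <;> linarith }

end LobeSequences

section Phase

variable {τ ρ L T M C : ℝ} {X ψ y : ℝ → ℝ} {a b c : ℕ → ℝ}

theorem Profile.X_sub_le (P : Profile τ ρ L X ψ) {u v : ℝ} (huv : u ≤ v) : X u - X v ≤ v - u := by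
  rcases le_total ρ u with hu | hu
  · rw [P.X_of_ge u hu, P.X_of_ge v (hu.trans huv)]
    linarith
  rcases le_total v 0 with hv | hv
  · rw [P.X_of_nonpos u (huv.trans hv), P.X_of_nonpos v hv]
    linarith
  have hρ := P.ρ_pos
  have h1 := P.X_step (max u 0) (min v ρ) (le_max_right _ _)
    (max_le (le_min huv hu) (le_min hv hρ.le)) (min_le_right _ _)
  have h2 : X (max u 0) = X u := by
    rcases le_total u 0 with h | h
    · rw [max_eq_right h, P.X_of_nonpos u h, P.X_of_nonpos 0 le_rfl]
    · rw [max_eq_left h]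
  have h3 : X (min v ρ) = X v := by
    rcases le_total v ρ with h | h
    · rw [min_eq_left h]
    · rw [min_eq_right h, P.X_of_ge v h, P.X_of_ge ρ le_rfl]
  have h4 : ∫ s in (max u 0)..(min v ρ), X (s - τ) ≤ ∫ s in (max u 0)..(min v ρ), (1 : ℝ) :=
    intervalIntegral.integral_mono_on (max_le (le_min huv hu) (le_min hv hρ.le))
      ((P.X_shift_cont τ).intervalIntegrable _ _) intervalIntegrable_const
      fun s _ => P.X_le_one _
  rw [intervalIntegral.integral_const, smul_eq_mul, mul_one] at h4
  rw [h2, h3] at h1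
  linarith [le_max_left u 0, min_le_left v ρ]

/-- The phases of consecutive lobes converge. -/
theorem LobeSequence.exists_phase (Q : LobeSequence τ ρ L M C X ψ y a b c) (hC : 0 ≤ C) :
    ∃ α, Tendsto (fun n => a n - n * (ρ + L)) atTop (nhds α) := by
  set B : ℕ → ℝ := fun n => a (n + 1) - (n + 1 : ℕ) * (ρ + L) with hB
  have hanti : Antitone fun n => B n + C * y (c (n + 1)) := by
    refine antitone_nat_of_succ_le fun n => ?_
    simp only [hB]
    push_cast
    linarith [Q.len_le (n + 1), Q.gap_le (n + 1)]
  have hmono : Monotone fun n => B n - C * y (c n) := by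
    refine monotone_nat_of_le_succ fun n => ?_
    simp only [hB]
    push_cast
    linarith [Q.rise_ge n, Q.fall_ge (n + 1), Q.b_le_a (n + 1)]
  have hbdd : BddBelow (range fun n => B n + C * y (c (n + 1))) := by
    refine ⟨B 0 - C * y (c 0), ?_⟩
    rintro _ ⟨n, rfl⟩
    have h1 : B 0 - C * y (c 0) ≤ B n - C * y (c n) := hmono (Nat.zero_le n)
    have h2 := mul_nonneg hC (Q.top_pos n).le
    have h3 := mul_nonneg hC (Q.top_pos (n + 1)).le
    dsimp only
    linarith
  have h1 := (tendsto_atTop_ciInf hanti hbdd).sub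
    ((Q.tendsto_top.comp (tendsto_add_atTop_nat 1)).const_mul C)
  refine ⟨_, (tendsto_add_atTop_iff_nat 1).mp (h1.congr fun n => ?_)⟩
  simp [hB]

theorem LobeSequence.tendsto_left (Q : LobeSequence τ ρ L M C X ψ y a b c) (hρ : 0 < ρ) :
    Tendsto a atTop atTop :=
  tendsto_atTop_of_add_le_succ hρ fun n => by
    linarith [Q.b_le_a n, Q.fall_ge n, Q.a_le_c n]

theorem LobeSequence.left_mono (Q : LobeSequence τ ρ L M C X ψ y a b c) (hρ : 0 < ρ) :
    Monotone a :=
  monotone_nat_of_le_succ fun n => by linarith [Q.b_le_a n, Q.fall_ge n, Q.a_le_c n]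

theorem LobeSequence.le_profile (Q : LobeSequence τ ρ L M C X ψ y a b c)
    (W : WindowSystem τ (ρ + L) T y) (P : Profile τ ρ L X ψ) (n : ℕ) (hT : T ≤ a (n + 1)) {s : ℝ}
    (hs : 0 ≤ s) (hsb : a (n + 1) + s ≤ b (n + 1)) :
    y (a (n + 1) + s) ≤ y (c n) * min (ψ s) (X (s - L)) := by
  have hm := Q.top_pos n
  have h1 := Q.growth n s hs
  rcases le_total s L with h | h
  · rwa [P.X_of_nonpos (s - L) (by linarith), min_eq_left (by rw [← P.ψ_L]; exact P.ψ_mono h)]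
  · have hmin : X (s - L) ≤ ψ s := by
      have := P.ψ_mono h
      rw [P.ψ_L] at this
      exact (P.X_le_one _).trans this
    have hcs : c (n + 1) ≤ a (n + 1) + s := by linarith [Q.rise_le (n + 1)]
    have h2 := (W.decay P (c := c (n + 1)) (d := b (n + 1)) (u := ρ)
      (hT.trans (Q.a_le_c _)) (hcs.trans hsb) (Q.top_pos _) (Q.le_top _) P.ρ_pos.le le_rfl
      (by rw [Q.right, P.X_of_ge ρ le_rfl, mul_zero]) (Or.inl rfl)).2 _ ⟨hcs, hsb⟩
    rw [min_eq_right hmin]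
    refine h2.trans (mul_le_mul (Q.top_le n) (P.X_anti ?_) (P.X_nonneg _) hm.le)
    linarith [Q.len_le (n + 1)]

theorem LobeSequence.profile_le_rise (Q : LobeSequence τ ρ L M C X ψ y a b c)
    (W : WindowSystem τ (ρ + L) T y) (P : Profile τ ρ L X ψ) (n : ℕ) (hT : T ≤ a (n + 1)) {s : ℝ}
    (hs : 0 ≤ s) (hsc : a (n + 1) + s ≤ c (n + 1)) :
    y (c n) * ψ s - (y (c n) - y (c (n + 1))) ≤ y (a (n + 1) + s) := by
  have hm := Q.top_pos n
  have h1 := W.slope (a (n + 1) + s) (c (n + 1)) (by linarith) hsc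
    (fun v => y (c n) * max (X (ρ + (v - a (n + 1)) - τ)) (ψ (v - a (n + 1))))
    (continuous_const.mul (P.rate_cont.comp (continuous_sub_right _))) ?_
  · rw [intervalIntegral.integral_comp_sub_right (fun v => y (c n) * max (X (ρ + v - τ)) (ψ v)),
      intervalIntegral.integral_const_mul, add_sub_cancel_left] at h1
    have h2 := P.ψ_step s (c (n + 1) - a (n + 1)) hs (by linarith)
    have h3 := P.ψ_mono (Q.rise_le (n + 1))
    rw [P.ψ_L] at h3
    have h4 : y (c n) * ∫ v in s..(c (n + 1) - a (n + 1)), max (X (ρ + v - τ)) (ψ v) ≤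
        y (c n) * (1 - ψ s) := mul_le_mul_of_nonneg_left (by linarith) hm.le
    linarith [le_abs_self (y (c (n + 1)) - y (a (n + 1) + s))]
  · intro v hv r hr
    rcases le_total (a (n + 1)) r with h | h
    · have h2 := Q.growth n (r - a (n + 1)) (by linarith)
      rw [add_sub_cancel] at h2
      exact h2.trans (mul_le_mul_of_nonneg_left
        (le_max_of_le_right (P.ψ_mono (by linarith [hr.2]))) hm.le)
    · have h2 := Q.before n r ⟨by linarith [hr.1, hv.1], h⟩
      exact h2.trans (mul_le_mul_of_nonneg_left
        (le_max_of_le_left (P.X_anti (by linarith [hr.1]))) hm.le)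

theorem LobeSequence.profile_le_fall (Q : LobeSequence τ ρ L M C X ψ y a b c)
    (W : WindowSystem τ (ρ + L) T y) (P : Profile τ ρ L X ψ) (n : ℕ) (hT : T ≤ c n) {t : ℝ}
    (hct : c n ≤ t) (htb : t ≤ b n) : y (c n) * X (t - c n) ≤ y t := by
  have hm := Q.top_pos n
  have hρ := P.ρ_pos
  have hy : y t ≤ y (c n) := Q.le_top n t ⟨by linarith [P.τ_pos], htb⟩
  obtain ⟨u, hu, hXu⟩ := intermediate_value_Icc' hρ.le P.X_cont.continuousOn
    (show y t / y (c n) ∈ Icc (X ρ) (X 0) by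
      rw [P.X_of_ge ρ le_rfl, P.X_of_nonpos 0 le_rfl]
      exact ⟨div_nonneg (W.nonneg t) hm.le, (div_le_one hm).mpr hy⟩)
  have hyu : y (c n) * X u = y t := by rw [hXu]; field_simp
  have h1 := (W.decay P (c := c n) (d := t) (u := u) hT hct hm
    (fun r hr => Q.le_top n r ⟨hr.1, hr.2.trans htb⟩) hu.1 hu.2 hyu.ge (Or.inl rfl)).1
  rw [← hyu]
  exact mul_le_mul_of_nonneg_left (P.X_anti h1) hm.le

/-- On one period starting at a lobe, `y` is close to `M` times the extremal profile. -/
theorem LobeSequence.abs_sub_profile_le (Q : LobeSequence τ ρ L M C X ψ y a b c)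
    (W : WindowSystem τ (ρ + L) T y) (P : Profile τ ρ L X ψ) (hM : 0 < M) (hC : 0 ≤ C) {S : ℝ}
    (hS : ∀ t ≥ T - τ, y t ≤ S) (n : ℕ) (hT : T ≤ a (n + 1)) {s : ℝ} (hs : 0 ≤ s)
    (hsa : a (n + 1) + s ≤ a (n + 2)) :
    |y (a (n + 1) + s) - M * min (ψ s) (X (s - L))| ≤
      |y (c n) - M| + |y (c (n + 1)) - M| + (1 + S * C + M * C) * (y (c n) - y (c (n + 2))) := by
  have hTc := hT.trans (Q.a_le_c (n + 1))
  have hD₁ : 0 ≤ y (c n) - y (c (n + 1)) := sub_nonneg.mpr (Q.top_le n)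
  have hD₂ : 0 ≤ y (c (n + 1)) - y (c (n + 2)) := sub_nonneg.mpr (Q.top_le (n + 1))
  have hD : 0 ≤ y (c n) - y (c (n + 2)) := by linarith
  have hcS : y (c (n + 1)) ≤ S := hS _ (by linarith [P.τ_pos])
  have hS0 : 0 ≤ S := (Q.top_pos (n + 1)).le.trans hcS
  have hw0 : 0 ≤ min (ψ s) (X (s - L)) := le_min (P.ψ_nonneg _) (P.X_nonneg _)
  have hw1 : min (ψ s) (X (s - L)) ≤ 1 := (min_le_right _ _).trans (P.X_le_one _)
  have hMw : 0 ≤ M * min (ψ s) (X (s - L)) := mul_nonneg hM.le hw0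
  have hSC := mul_nonneg hS0 hC
  have hMC := mul_nonneg hM.le hC
  have hrise := Q.rise_ge n
  have h0 := abs_nonneg (y (c n) - M)
  have h0' := abs_nonneg (y (c (n + 1)) - M)
  have hCD : C * (y (c n) - y (c (n + 1))) ≤ C * (y (c n) - y (c (n + 2))) :=
    mul_le_mul_of_nonneg_left (by linarith) hC
  have hCD₂ : C * (y (c (n + 1)) - y (c (n + 2))) ≤ C * (y (c n) - y (c (n + 2))) :=
    mul_le_mul_of_nonneg_left (by linarith) hC
  have hSCD := mul_nonneg hSC hD
  have hMCD := mul_nonneg hMC hD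
  have hfac : ∀ m, m * min (ψ s) (X (s - L)) - M * min (ψ s) (X (s - L)) ≤ |m - M| ∧
      M * min (ψ s) (X (s - L)) - m * min (ψ s) (X (s - L)) ≤ |m - M| := by
    intro m
    have h1 : |m - M| * min (ψ s) (X (s - L)) ≤ |m - M| * 1 :=
      mul_le_mul_of_nonneg_left hw1 (abs_nonneg _)
    have h2 := mul_le_mul_of_nonneg_right (le_abs_self (m - M)) hw0
    have h3 := mul_le_mul_of_nonneg_right (neg_le_abs (m - M)) hw0
    constructor <;> linarith
  rw [abs_le]
  rcases le_total (a (n + 1) + s) (b (n + 1)) with hb | hb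
  · have hup := Q.le_profile W P n hT hs hb
    refine ⟨?_, by linarith [(hfac (y (c n))).1]⟩
    rcases le_total (a (n + 1) + s) (c (n + 1)) with hc | hc
    · have h1 := Q.profile_le_rise W P n hT hs hc
      have h2 : y (c n) * min (ψ s) (X (s - L)) ≤ y (c n) * ψ s :=
        mul_le_mul_of_nonneg_left (min_le_left _ _) (Q.top_pos n).le
      linarith [(hfac (y (c n))).2]
    · have h1 := Q.profile_le_fall W P (n + 1) hTc hc hb
      have h2 := P.X_sub_le (u := s - L) (v := a (n + 1) + s - c (n + 1))
        (by linarith [Q.rise_le (n + 1)])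
      have h3 : X (s - L) - C * (y (c n) - y (c (n + 2))) ≤ X (a (n + 1) + s - c (n + 1)) := by
        linarith
      have h4 := mul_le_mul_of_nonneg_left h3 (Q.top_pos (n + 1)).le
      have h5 : y (c (n + 1)) * min (ψ s) (X (s - L)) ≤ y (c (n + 1)) * X (s - L) :=
        mul_le_mul_of_nonneg_left (min_le_right _ _) (Q.top_pos (n + 1)).le
      have h6 : y (c (n + 1)) * (C * (y (c n) - y (c (n + 2)))) ≤
          S * (C * (y (c n) - y (c (n + 2)))) :=
        mul_le_mul_of_nonneg_right hcS (mul_nonneg hC hD)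
      linarith [(hfac (y (c (n + 1)))).2]
  · have hfall := Q.fall_ge (n + 1)
    have h1 := W.lipschitz (S := S) (by linarith [P.ρ_pos]) hb fun r hr => hS r hr
    rw [Q.right, sub_zero] at h1
    have h2 := Q.gap_le (n + 1)
    have h3 : S * (a (n + 1) + s - b (n + 1)) ≤ S * (C * (y (c n) - y (c (n + 2)))) :=
      mul_le_mul_of_nonneg_left (by linarith) hS0
    have h4 : X (s - L) ≤ C * (y (c n) - y (c (n + 2))) := by
      rcases le_total ρ (s - L) with h | h
      · rw [P.X_of_ge _ h]; exact mul_nonneg hC hD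
      · have := P.X_sub_le h
        rw [P.X_of_ge ρ le_rfl] at this
        linarith
    have h5 : M * min (ψ s) (X (s - L)) ≤ M * (C * (y (c n) - y (c (n + 2)))) :=
      mul_le_mul_of_nonneg_left ((min_le_right _ _).trans h4) hM.le
    have h6 := le_abs_self (y (a (n + 1) + s))
    have h7 := W.nonneg (a (n + 1) + s)
    constructor <;> linarith

end Phase

section Convergence

variable {τ ρ L T M : ℝ} {X ψ y ϖ : ℝ → ℝ}

theorem Function.Periodic.uniformContinuous_of_continuousOn {Λ : ℝ} (hper : Function.Periodic ϖ Λ)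
    (hΛ : 0 < Λ) (hc : ContinuousOn ϖ (Icc 0 Λ)) : UniformContinuous ϖ := by
  have : Fact (0 < Λ) := ⟨hΛ⟩
  have h0 : ϖ 0 = ϖ Λ := by simpa using (hper 0).symm
  have h1 : UniformContinuous (AddCircle.liftIco Λ 0 ϖ) :=
    CompactSpace.uniformContinuous_of_continuous (AddCircle.liftIco_zero_continuous h0 hc)
  have h2 : UniformContinuous (QuotientAddGroup.mk' (AddSubgroup.zmultiples Λ)) :=
    uniformContinuous_of_continuousAt_zero _ continuous_quotient_mk'.continuousAt
  convert h1.comp h2 using 1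
  funext t
  have h3 : toIcoMod hΛ 0 t ∈ Ico 0 (0 + Λ) := toIcoMod_mem_Ico hΛ 0 t
  have h4 : ((toIcoMod hΛ 0 t : ℝ) : AddCircle Λ) = (t : AddCircle Λ) := by
    rw [toIcoMod, AddCircle.coe_sub, AddCircle.coe_zsmul, AddCircle.coe_period, smul_zero, sub_zero]
  change ϖ t = AddCircle.liftIco Λ 0 ϖ (t : AddCircle Λ)
  rw [← h4, AddCircle.liftIco_coe_apply h3, toIcoMod, hper.sub_zsmul_eq]

/-- Asymptotically, a window system with positive limit superior is a phase shift of the periodic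
extremal profile. -/
theorem WindowSystem.exists_tendsto_profile (W : WindowSystem τ (ρ + L) T y)
    (P : Profile τ ρ L X ψ) (hM : WindowSystem.IsTop τ ρ M y)
    (hper : Function.Periodic ϖ (ρ + L))
    (hϖ : ∀ s ∈ Icc 0 (ρ + L), ϖ s = min (ψ s) (X (s - L))) :
    ∃ α, Tendsto (fun t => y t - M * ϖ (t - α)) atTop (nhds 0) := by
  have hρ := P.ρ_pos
  have hL := P.L_pos
  have hτ := P.τ_pos
  have hM0 := hM.pos
  obtain ⟨S, hS, hle⟩ := W.eventually_bounded P
  obtain ⟨C, hC, a, b, c, ha0, Q⟩ := W.exists_lobeSequence P hM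
  obtain ⟨α, hα⟩ := Q.exists_phase hC
  have hW := W.mono (show T ≤ T + τ by linarith)
  have huc : UniformContinuous ϖ :=
    hper.uniformContinuous_of_continuousOn (by linarith)
      (((P.ψ_cont.min (P.X_shift_cont L)).continuousOn).congr hϖ)
  refine ⟨α, Metric.tendsto_atTop.mpr fun ε hε => ?_⟩
  obtain ⟨d, hd, hdϖ⟩ := Metric.uniformContinuous_iff.mp huc (ε / (2 * M)) (by positivity)
  have htop : ∀ k, Tendsto (fun n => y (c (n + k))) atTop (nhds M) := fun k =>
    Q.tendsto_top.comp (tendsto_add_atTop_nat k)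
  have hE : Tendsto (fun n => |y (c n) - M| + |y (c (n + 1)) - M| +
      (1 + S * C + M * C) * (y (c n) - y (c (n + 2)))) atTop (nhds 0) := by
    have := ((((htop 0).sub_const M).abs.add ((htop 1).sub_const M).abs).add
      (((htop 0).sub (htop 2)).const_mul (1 + S * C + M * C)))
    simpa using this
  have hG : Tendsto (fun n => C * (y (c (n + 1)) - y (c (n + 2)))) atTop (nhds 0) := by
    simpa using ((htop 1).sub (htop 2)).const_mul C
  have hA : Tendsto (fun n => |a (n + 1) - (n + 1 : ℕ) * (ρ + L) - α|) atTop (nhds 0) := by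
    simpa using ((hα.comp (tendsto_add_atTop_nat 1)).sub_const α).abs
  have hat := Q.tendsto_left hρ
  obtain ⟨n₀, hn₀⟩ := eventually_atTop.mp ((hE.eventually_lt_const (half_pos hε)).and
    ((hG.eventually_lt_const (half_pos hd)).and ((hA.eventually_lt_const (half_pos hd)).and
      ((hat.comp (tendsto_add_atTop_nat 1)).eventually_ge_atTop (T + τ)))))
  refine ⟨a (n₀ + 1), fun t ht => ?_⟩
  have hex : ∃ k, t < a k := (hat.eventually_gt_atTop t).exists
  obtain ⟨n, hn, hat1, hat2⟩ : ∃ n ≥ n₀, a (n + 1) ≤ t ∧ t < a (n + 2) := by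
    have h1 := Nat.find_spec hex
    have h2 : n₀ + 1 < Nat.find hex := by
      by_contra hn
      push Not at hn
      linarith [Q.left_mono hρ hn]
    obtain ⟨n, hn⟩ : ∃ n, Nat.find hex = n + 2 := ⟨Nat.find hex - 2, by omega⟩
    refine ⟨n, by omega, ?_, hn ▸ h1⟩
    exact not_lt.mp (Nat.find_min hex (by omega))
  obtain ⟨hEn, hGn, hAn, hTn⟩ := hn₀ n hn
  have hTn' : T + τ ≤ a (n + 1) := hTn
  set s := t - a (n + 1) with hs
  have hs0 : 0 ≤ s := by linarith
  have hts : a (n + 1) + s = t := by rw [hs]; ring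
  have h1 := Q.abs_sub_profile_le hW P hM0 hC (fun r hr => hle r (by linarith)) n hTn' hs0
    (by linarith)
  rw [hts] at h1
  have h2 : min (ψ s) (X (s - L)) = ϖ (min s (ρ + L)) := by
    rcases le_total s (ρ + L) with h | h
    · rw [min_eq_left h, hϖ s ⟨hs0, h⟩]
    · rw [min_eq_right h, hϖ _ ⟨by linarith, le_rfl⟩, P.X_of_ge (s - L) (by linarith),
        P.X_of_ge (ρ + L - L) (by linarith), min_eq_right (P.ψ_nonneg _),
        min_eq_right (P.ψ_nonneg _)]
  have h3 : ϖ (t - α) = ϖ (t - α - (n + 1 : ℕ) * (ρ + L)) := (hper.sub_nat_mul_eq _).symm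
  have h4 : dist (min s (ρ + L)) (t - α - (n + 1 : ℕ) * (ρ + L)) < d := by
    have h5 : s - (ρ + L) < d / 2 := by
      linarith [Q.len_le (n + 1), Q.gap_le (n + 1)]
    have h6 := abs_lt.mp hAn
    rw [Real.dist_eq, abs_lt]
    rcases le_total s (ρ + L) with h | h
    · rw [min_eq_left h]
      constructor <;> linarith
    · rw [min_eq_right h]
      constructor <;> linarith
  have h5 := hdϖ h4
  rw [← h2, ← h3, Real.dist_eq, lt_div_iff₀ (by positivity)] at h5
  rw [dist_zero_right, Real.norm_eq_abs]
  calc |y t - M * ϖ (t - α)|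
      = |(y t - M * min (ψ s) (X (s - L))) + M * (min (ψ s) (X (s - L)) - ϖ (t - α))| := by
        congr 1; ring
    _ ≤ |y t - M * min (ψ s) (X (s - L))| + |M * (min (ψ s) (X (s - L)) - ϖ (t - α))| :=
        abs_add_le _ _
    _ < ε := by
        rw [abs_mul, abs_of_pos hM0]
        linarith

theorem WindowSystem.tendsto_zero_of_limsup_le (W : WindowSystem τ (ρ + L) T y)
    (P : Profile τ ρ L X ψ) (h : limsup y atTop ≤ 0) : Tendsto y atTop (nhds 0) := by
  obtain ⟨S, -, hle⟩ := W.eventually_bounded P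
  have hbdd : IsBoundedUnder (· ≤ ·) atTop y :=
    ⟨S, eventually_map.mpr (eventually_atTop.mpr ⟨T, hle⟩)⟩
  refine tendsto_order.mpr ⟨fun e he => Eventually.of_forall fun t => he.trans_le (W.nonneg t),
    fun e he => eventually_lt_of_limsup_lt (h.trans_lt he) hbdd⟩

end Convergence

theorem stmt16 (τ : ℝ) (hτ : τ ∈ Ioo (1 / Real.exp 1) 2)
    (xτ : ℝ → ℝ) (hxτ : IsXSol τ xτ) (ρ : ℝ) (hρ : ρ = firstRoot xτ)
    (ψ : ℝ → ℝ) (hψ : IsPsiSol τ ρ xτ ψ)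
    (Λτ : ℝ) (hΛ : ρ < Λτ ∧ ψ (Λτ - ρ) = 1)
    (ϖ : ℝ → ℝ) (hper : Function.Periodic ϖ Λτ)
    (hϖ1 : ∀ t ∈ Icc (0:ℝ) (Λτ - ρ), ϖ t = ψ t)
    (hϖ2 : ∀ t ∈ Icc (Λτ - ρ) Λτ, ϖ t = xτ (t - (Λτ - ρ)))
    (p τd : ℝ → ℝ) (hpm : Measurable p)
    (hploc : MeasureTheory.LocallyIntegrable p)
    (hτdm : Measurable τd) (hτdle : ∀ t, τd t ≤ t)
    (hτdinf : Filter.Tendsto τd Filter.atTop Filter.atTop)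
    (t₀ : ℝ) (x : ℝ → ℝ) (hx : IsDelaySolution p τd t₀ x)
    (hosc : AlphaOscillating Λτ x)
    (hp1 : ∀ᵐ t : ℝ ∂volume, |p t| = 1)
    (hτm : ∀ t ≥ t₀, t - τd t ≤ τ)
    (M : ℝ) (hM : M = Filter.limsup (fun s => |x s|) Filter.atTop) :
    ∃ η ∈ Ico (0:ℝ) Λτ,
      Filter.Tendsto (fun t => |x t| - M * ϖ (t + η)) Filter.atTop (nhds 0) := by
  have P := hxτ.profile hτ hρ hψ hΛ
  have hρ0 := P.ρ_pos
  have hΛ0 : 0 < Λτ := by linarith [hΛ.1]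
  obtain ⟨T, hT⟩ := hosc
  have W := hx.windowSystem hpm hτdm hτdle hp1 hτm hT
  rw [show Λτ = ρ + (Λτ - ρ) by ring] at W
  rcases le_or_gt M 0 with hM0 | hM0
  · have h0 := W.tendsto_zero_of_limsup_le P (hM ▸ hM0)
    have hM' : M = 0 := hM.trans h0.limsup_eq
    exact ⟨0, ⟨le_rfl, hΛ0⟩, by simpa [hM'] using h0⟩
  · have hϖ : ∀ s ∈ Icc 0 (ρ + (Λτ - ρ)),
        ϖ s = min (ψ (max s 0)) (xτ (min (s - (Λτ - ρ)) ρ)) := by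
      intro s hs
      rw [add_sub_cancel] at hs
      rcases le_total s (Λτ - ρ) with h | h
      · rw [hϖ1 s ⟨hs.1, h⟩, max_eq_left hs.1, min_eq_left]
        have h1 := P.ψ_mono h
        have h2 := P.ψ_L
        have h3 := P.X_of_nonpos (s - (Λτ - ρ)) (by linarith)
        simp only [max_eq_left hs.1] at h1 h2 h3
        rw [h3]
        linarith
      · rw [hϖ2 s ⟨h, hs.2⟩, min_eq_left (show s - (Λτ - ρ) ≤ ρ by linarith [hs.2]), min_eq_right]
        have h1 := P.ψ_mono h
        have h2 := P.ψ_L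
        have h3 := P.X_le_one (s - (Λτ - ρ))
        simp only [min_eq_left (show s - (Λτ - ρ) ≤ ρ by linarith [hs.2])] at h1 h2 h3
        linarith
    obtain ⟨α, hα⟩ := W.exists_tendsto_profile P (W.isTop P hM hM0)
      (by rwa [add_sub_cancel]) hϖ
    refine ⟨toIcoMod hΛ0 0 (-α), by simpa using toIcoMod_mem_Ico hΛ0 0 (-α), ?_⟩
    refine hα.congr fun t => ?_
    rw [toIcoMod, ← add_sub_assoc, hper.sub_zsmul_eq, sub_eq_add_neg t α]
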